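/- arXiv:1812.10344 — 6 statements merged into one kernel-verified Lean document; each statement's English description precedes it below -/
import Mathlib

section
/- Let μ ∈ ℝ and σ > 0, and let X be a real random variable with E|X| < ∞. Then X has the normal distribution N(μ, σ²) if and only if for every continuously differentiable g : ℝ → ℝ with g and g' bounded one has E[(X − μ) g(X)] = σ² E[g'(X)]. -/
open MeasureTheory ProbabilityTheory

open scoped NNReal

lemma integrable_gaussianReal_iff_integrable_mul {m : ℝ} {v : ℝ≥0} (hv : v ≠ 0) {f : ℝ → ℝ} :
    Integrable f (gaussianReal m v) ↔ Integrable fun x ↦ gaussianPDFReal m v x * f x := by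
  rw [gaussianReal_of_var_ne_zero m hv, integrable_withDensity_iff_integrable_smul'
    (measurable_gaussianPDF m v) (ae_of_all _ fun _ ↦ gaussianPDF_lt_top)]
  simp only [toReal_gaussianPDF, smul_eq_mul]

lemma hasDerivAt_gaussianPDFReal (m : ℝ) {v : ℝ≥0} (hv : v ≠ 0) (x : ℝ) :
    HasDerivAt (gaussianPDFReal m v) (-((x - m) / v) * gaussianPDFReal m v x) x := by
  have hv' : (v : ℝ) ≠ 0 := by exact_mod_cast hv
  have h := (((((hasDerivAt_id x).sub_const m).pow 2).neg.div_const (2 * (v : ℝ))).exp).const_mul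
    (√(2 * Real.pi * v))⁻¹
  refine h.congr_deriv ?_
  simp only [gaussianPDFReal, id, Pi.neg_apply, Pi.pow_apply]
  push_cast
  field_simp

/-- Gaussian integration by parts. -/
lemma integral_sub_mul_gaussianReal {m : ℝ} {v : ℝ≥0} (hv : v ≠ 0) {g g' : ℝ → ℝ}
    (hg : ∀ x, HasDerivAt g (g' x) x) (hgi : Integrable g (gaussianReal m v))
    (hxg : Integrable (fun x ↦ (x - m) * g x) (gaussianReal m v))
    (hg'i : Integrable g' (gaussianReal m v)) :
    ∫ x, (x - m) * g x ∂(gaussianReal m v) = v * ∫ x, g' x ∂(gaussianReal m v) := by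
  have hv' : (v : ℝ) ≠ 0 := by exact_mod_cast hv
  rw [integrable_gaussianReal_iff_integrable_mul hv] at hgi hxg hg'i
  simp only [integral_gaussianReal_eq_integral_smul hv, smul_eq_mul]
  have key := integral_mul_deriv_eq_deriv_mul_of_integrable
    (fun x _ ↦ hasDerivAt_gaussianPDFReal m hv x) (fun x _ ↦ hg x) hg'i
    ((hxg.const_mul (-(v : ℝ)⁻¹)).congr (ae_of_all _ fun x ↦ by simp only [Pi.mul_apply]; ring)) hgi
  rw [key, ← integral_neg, ← integral_const_mul]
  congr 1 with x
  field_simp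

lemma hasDerivAt_charFun {ν : Measure ℝ} [IsFiniteMeasure ν] (hν : Integrable id ν) (t : ℝ) :
    HasDerivAt (charFun ν) (Complex.I * ∫ x, x * Complex.exp (t * x * Complex.I) ∂ν) t := by
  have hint : MemLp id ((1 : ℕ) : ENNReal) ν := by simpa using memLp_one_iff_integrable.2 hν
  have h := ((contDiff_charFun hint).differentiable (by simp) t).hasDerivAt
  rw [← iteratedDeriv_one, iteratedDeriv_charFun hint] at h
  simpa only [pow_one] using h

/-- The Stein identity for the functions `cos (t x)` and `sin (t x)`, in complex form. -/
lemma integral_sub_mul_cexp_of_stein {ν : Measure ℝ} [IsFiniteMeasure ν] (hν : Integrable id ν)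
    {m v : ℝ} (h : ∀ g : ℝ → ℝ, ContDiff ℝ 1 g → (∃ C, ∀ x, |g x| ≤ C) →
      (∃ C, ∀ x, |deriv g x| ≤ C) → ∫ x, (x - m) * g x ∂ν = v * ∫ x, deriv g x ∂ν) (t : ℝ) :
    ∫ x, (x - m : ℂ) * Complex.exp (t * x * Complex.I) ∂ν =
      v * t * Complex.I * charFun ν t := by
  have hexp (x : ℝ) : Complex.exp (t * x * Complex.I) =
      (Real.cos (t * x) : ℂ) + (Real.sin (t * x) : ℂ) * Complex.I := by
    push_cast
    rw [Complex.exp_mul_I]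
  have hdc : deriv (fun x ↦ Real.cos (t * x)) = fun x ↦ -t * Real.sin (t * x) := by
    ext x
    refine (((hasDerivAt_id x).const_mul t).cos.congr_deriv ?_).deriv
    simp only [id]; ring
  have hds : deriv (fun x ↦ Real.sin (t * x)) = fun x ↦ t * Real.cos (t * x) := by
    ext x
    refine (((hasDerivAt_id x).const_mul t).sin.congr_deriv ?_).deriv
    simp only [id]; ring
  have hc := h (fun x ↦ Real.cos (t * x)) (by fun_prop) ⟨1, fun x ↦ Real.abs_cos_le_one _⟩
    ⟨|t|, fun x ↦ by
      rw [hdc, abs_mul, abs_neg]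
      exact mul_le_of_le_one_right (abs_nonneg _) (Real.abs_sin_le_one _)⟩
  have hs := h (fun x ↦ Real.sin (t * x)) (by fun_prop) ⟨1, fun x ↦ Real.abs_sin_le_one _⟩
    ⟨|t|, fun x ↦ by
      rw [hds, abs_mul]
      exact mul_le_of_le_one_right (abs_nonneg _) (Real.abs_cos_le_one _)⟩
  simp only [hdc, hds, integral_const_mul] at hc hs
  have hci : Integrable (fun x ↦ Real.cos (t * x)) ν :=
    .of_bound (by fun_prop) 1 (ae_of_all _ fun x ↦ Real.abs_cos_le_one _)
  have hsi : Integrable (fun x ↦ Real.sin (t * x)) ν :=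
    .of_bound (by fun_prop) 1 (ae_of_all _ fun x ↦ Real.abs_sin_le_one _)
  have hxm : Integrable (fun x ↦ x - m) ν := hν.sub (integrable_const m)
  have hxc : Integrable (fun x ↦ (x - m) * Real.cos (t * x)) ν :=
    hxm.mul_bdd (c := 1) (by fun_prop) (ae_of_all _ fun x ↦ Real.abs_cos_le_one _)
  have hxs : Integrable (fun x ↦ (x - m) * Real.sin (t * x)) ν :=
    hxm.mul_bdd (c := 1) (by fun_prop) (ae_of_all _ fun x ↦ Real.abs_sin_le_one _)
  have hl : ∫ x, (x - m : ℂ) * Complex.exp (t * x * Complex.I) ∂ν =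
      ((∫ x, (x - m) * Real.cos (t * x) ∂ν : ℝ) : ℂ) +
        ((∫ x, (x - m) * Real.sin (t * x) ∂ν : ℝ) : ℂ) * Complex.I := by
    rw [← integral_complex_ofReal, ← integral_complex_ofReal, ← integral_mul_const,
      ← integral_add hxc.ofReal (hxs.ofReal.mul_const _)]
    congr 1 with x
    rw [hexp]
    push_cast
    ring
  have hr : charFun ν t = ((∫ x, Real.cos (t * x) ∂ν : ℝ) : ℂ) +
      ((∫ x, Real.sin (t * x) ∂ν : ℝ) : ℂ) * Complex.I := by
    rw [charFun_apply_real, ← integral_complex_ofReal, ← integral_complex_ofReal,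
      ← integral_mul_const, ← integral_add hci.ofReal (hsi.ofReal.mul_const _)]
    simp only [hexp]
  rw [hl, hr, hc, hs]
  push_cast
  linear_combination (-(v : ℂ) * t * ((∫ x, Real.sin (t * x) ∂ν : ℝ) : ℂ)) * Complex.I_sq

lemma charFun_eq_of_stein {ν : Measure ℝ} [IsProbabilityMeasure ν] (hν : Integrable id ν)
    {m v : ℝ} (h : ∀ g : ℝ → ℝ, ContDiff ℝ 1 g → (∃ C, ∀ x, |g x| ≤ C) →
      (∃ C, ∀ x, |deriv g x| ≤ C) → ∫ x, (x - m) * g x ∂ν = v * ∫ x, deriv g x ∂ν) (t : ℝ) :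
    charFun ν t = Complex.exp (t * m * Complex.I - v * t ^ 2 / 2) := by
  have hφ (s : ℝ) : HasDerivAt (charFun ν) ((m * Complex.I - v * s) * charFun ν s) s := by
    refine (hasDerivAt_charFun hν s).congr_deriv ?_
    have hei : Integrable (fun x : ℝ ↦ Complex.exp (s * x * Complex.I)) ν :=
      .of_bound (by fun_prop) 1 (ae_of_all _ fun x ↦ by
        rw [← Complex.ofReal_mul, Complex.norm_exp_ofReal_mul_I])
    have hxei : Integrable (fun x : ℝ ↦ (x : ℂ) * Complex.exp (s * x * Complex.I)) ν :=
      hν.ofReal.mul_bdd (c := 1) (by fun_prop) (ae_of_all _ fun x ↦ by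
        rw [← Complex.ofReal_mul, Complex.norm_exp_ofReal_mul_I])
    have hS := integral_sub_mul_cexp_of_stein hν h s
    simp only [sub_mul] at hS
    rw [integral_sub hxei (hei.const_mul _), integral_const_mul, ← charFun_apply_real] at hS
    linear_combination Complex.I * hS + (v * s * charFun ν s) * Complex.I_sq
  have hψ (s : ℝ) : HasDerivAt
      (fun s : ℝ ↦ charFun ν s * Complex.exp (-(s * m * Complex.I - v * s ^ 2 / 2))) 0 s := by
    have hs : HasDerivAt (fun s : ℝ ↦ (s : ℂ)) 1 s := Complex.ofRealCLM.hasDerivAt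
    have he := ((((hs.mul_const (m : ℂ)).mul_const Complex.I).sub
      (((hs.pow 2).const_mul (v : ℂ)).div_const 2)).neg).cexp
    refine ((hφ s).mul he).congr_deriv ?_
    simp only [Pi.neg_apply, Pi.sub_apply, Pi.pow_apply]
    push_cast
    ring
  have hconst := is_const_of_deriv_eq_zero (fun s ↦ (hψ s).differentiableAt)
    (fun s ↦ (hψ s).deriv) t 0
  rw [Complex.exp_neg] at hconst
  simp only [charFun_zero, probReal_univ] at hconst
  rw [mul_inv_eq_iff_eq_mul₀ (Complex.exp_ne_zero _)] at hconst
  simpa using hconst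

/-- Stein's lemma: a real random variable `X` with `E|X| < ∞` has the normal
distribution `N(μ, σ²)` if and only if `E[(X − μ) g(X)] = σ² E[g'(X)]` for every
continuously differentiable `g` with `g` and `g'` bounded. -/
theorem stein_lemma_gaussian_characterization
    {Ω : Type*} [MeasureSpace Ω] [IsProbabilityMeasure (ℙ : Measure Ω)]
    (X : Ω → ℝ) (hXmeas : Measurable X) (hXint : Integrable X ℙ)
    (m σ : ℝ) (hσ : 0 < σ) :
    Measure.map X ℙ = gaussianReal m ((σ ^ 2).toNNReal) ↔
      ∀ g : ℝ → ℝ, ContDiff ℝ 1 g → (∃ C, ∀ x, |g x| ≤ C) →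
        (∃ C, ∀ x, |deriv g x| ≤ C) →
        ∫ ω, (X ω - m) * g (X ω) ∂ℙ = σ ^ 2 * ∫ ω, deriv g (X ω) ∂ℙ := by
  have hvcoe : (((σ ^ 2).toNNReal : ℝ≥0) : ℝ) = σ ^ 2 := Real.coe_toNNReal _ (sq_nonneg σ)
  have hv : (σ ^ 2).toNNReal ≠ 0 := by simpa using hσ.ne'
  have : IsProbabilityMeasure (Measure.map X ℙ) :=
    Measure.isProbabilityMeasure_map hXmeas.aemeasurable
  have hid : Integrable id (Measure.map X ℙ) :=
    (integrable_map_measure aestronglyMeasurable_id hXmeas.aemeasurable).2 hXint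
  have hmap (f : ℝ → ℝ) (hf : Continuous f) :
      ∫ x, f x ∂(Measure.map X ℙ) = ∫ ω, f (X ω) ∂ℙ :=
    integral_map hXmeas.aemeasurable hf.aestronglyMeasurable
  constructor
  · rintro h g hg ⟨C, hC⟩ ⟨D, hD⟩
    have hgc := hg.continuous
    have hg'c := hg.continuous_deriv le_rfl
    rw [← hmap (fun x ↦ (x - m) * g x) (by fun_prop), ← hmap _ hg'c]
    rw [h] at hid ⊢
    have key := integral_sub_mul_gaussianReal hv
      (fun x ↦ (hg.differentiable one_ne_zero x).hasDerivAt)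
      (.of_bound hgc.aestronglyMeasurable C (ae_of_all _ hC))
      ((hid.sub (integrable_const m)).mul_bdd hgc.aestronglyMeasurable (ae_of_all _ hC))
      (.of_bound hg'c.aestronglyMeasurable D (ae_of_all _ hD))
    rwa [hvcoe] at key
  · intro h
    refine Measure.ext_of_charFun ?_
    ext t
    rw [charFun_gaussianReal, hvcoe]
    refine charFun_eq_of_stein hid (fun g hg hgb hg'b ↦ ?_) t
    have hgc := hg.continuous
    rw [hmap (fun x ↦ (x - m) * g x) (by fun_prop), hmap _ (hg.continuous_deriv le_rfl)]
    exact h g hg hgb hg'b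
end

section
/- Let N, N₁, N₂ be i.i.d. random variables with distribution N(μ, σ²), and define K_γ(x, x') = P[N ≤ min(x, x')] − P[N ≤ x] P[N ≤ x'] for x, x' ∈ ℝ. Then: (i) K_γ(x, x') ≥ 0 for all x, x' ∈ ℝ; (ii) for every locally absolutely continuous h : ℝ → ℝ with E|h(N)| < ∞ and E[|h'(N)| K_γ(N, x)/γ(N)] < ∞, one has −L_γ h(x) = E[h'(N) K_γ(N, x)/(γ(N) γ(x))] for every x ∈ ℝ; (iii) for all locally absolutely continuous h, g : ℝ → ℝ with E[h(N)²] < ∞, E[g(N)²] < ∞ and the right-hand side below absolutely convergent, Cov[h(N), g(N)] = E[h'(N₁) (K_γ(N₁, N₂)/(γ(N₁) γ(N₂))) g'(N₂)]. -/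
open MeasureTheory ProbabilityTheory Set
open scoped NNReal

/-- The Gaussian covariance kernel `K_γ(x,x') = P[N ≤ min(x,x')] − P[N ≤ x]P[N ≤ x']`. -/
noncomputable def gaussK (m : ℝ) (v : ℝ≥0) (x x' : ℝ) : ℝ :=
  ((gaussianReal m v) (Iic (min x x'))).toReal -
    ((gaussianReal m v) (Iic x)).toReal * ((gaussianReal m v) (Iic x')).toReal

/-- The Gaussian inverse Stein operator
`L_γ h (x) = (1/γ(x)) ∫_{−∞}^x (h(u) − E[h(N)]) γ(u) du`. -/
noncomputable def gaussL (m : ℝ) (v : ℝ≥0) (h : ℝ → ℝ) (x : ℝ) : ℝ :=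
  (∫ u in Iic x, (h u - ∫ y, h y ∂(gaussianReal m v)) ∂(gaussianReal m v)) /
    gaussianPDFReal m v x

/-- `h` is locally absolutely continuous with a.e. derivative `h'`,
expressed through the fundamental theorem of calculus. -/
def HasAEDeriv (h h' : ℝ → ℝ) : Prop :=
  ∀ x y : ℝ, IntervalIntegrable h' MeasureTheory.volume x y ∧
    h y - h x = ∫ t in x..y, h' t

/-- The increment `1{u ≤ t} - 1{w ≤ t}`. -/
noncomputable def stepDiff (t : ℝ) (q : ℝ × ℝ) : ℝ :=
  (Iic t).indicator 1 q.1 - (Iic t).indicator 1 q.2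

theorem measurable_stepDiff_uncurry :
    Measurable (fun p : ℝ × (ℝ × ℝ) => stepDiff p.1 p.2) := by
  have h1 : (fun p : ℝ × (ℝ × ℝ) => stepDiff p.1 p.2) = fun p =>
      ({p : ℝ × (ℝ × ℝ) | p.2.1 ≤ p.1}.indicator 1 p : ℝ) -
        {p : ℝ × (ℝ × ℝ) | p.2.2 ≤ p.1}.indicator 1 p := by
    ext p
    simp [stepDiff, indicator]
  rw [h1]
  exact (measurable_one.indicator (measurableSet_le (by fun_prop) (by fun_prop))).sub
    (measurable_one.indicator (measurableSet_le (by fun_prop) (by fun_prop)))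

theorem stepDiff_mul_nonneg (s t : ℝ) (q : ℝ × ℝ) : 0 ≤ stepDiff s q * stepDiff t q := by
  simp only [stepDiff, indicator, mem_Iic, Pi.one_apply]
  split_ifs <;> first | (exfalso; linarith) | norm_num

theorem abs_stepDiff_mul_le_one (s t : ℝ) (q : ℝ × ℝ) : |stepDiff s q * stepDiff t q| ≤ 1 := by
  simp only [stepDiff, indicator, mem_Iic, Pi.one_apply]
  split_ifs <;> norm_num

/-- The covariance as half of the mean product of increments of two independent copies. -/
theorem integral_prod_sub_mul_sub {Ω : Type*} [MeasurableSpace Ω] (P : Measure Ω)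
    [IsProbabilityMeasure P] {X Y : Ω → ℝ} (hX : Integrable X P) (hY : Integrable Y P)
    (hXY : Integrable (fun u => X u * Y u) P) :
    ∫ q, (X q.1 - X q.2) * (Y q.1 - Y q.2) ∂(P.prod P) =
      2 * ((∫ u, X u * Y u ∂P) - (∫ u, X u ∂P) * ∫ u, Y u ∂P) := by
  have e1 : Integrable (fun q : Ω × Ω => X q.1 * Y q.1) (P.prod P) := hXY.comp_fst P
  have e2 : Integrable (fun q : Ω × Ω => X q.2 * Y q.2) (P.prod P) := hXY.comp_snd P
  have e3 : Integrable (fun q : Ω × Ω => X q.1 * Y q.2) (P.prod P) := hX.mul_prod hY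
  have e4 : Integrable (fun q : Ω × Ω => Y q.1 * X q.2) (P.prod P) := hY.mul_prod hX
  have i1 : ∫ q : Ω × Ω, X q.1 * Y q.1 ∂(P.prod P) = ∫ u, X u * Y u ∂P := by
    simpa using integral_fun_fst (μ := P) (ν := P) (fun u => X u * Y u)
  have i2 : ∫ q : Ω × Ω, X q.2 * Y q.2 ∂(P.prod P) = ∫ u, X u * Y u ∂P := by
    simpa using integral_fun_snd (μ := P) (ν := P) (fun u => X u * Y u)
  calc ∫ q, (X q.1 - X q.2) * (Y q.1 - Y q.2) ∂(P.prod P)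
      = ∫ q, ((X q.1 * Y q.1 + X q.2 * Y q.2) - (X q.1 * Y q.2 + Y q.1 * X q.2))
          ∂(P.prod P) := by
        congr 1; ext q; ring
    _ = _ := by
        rw [integral_sub (by exact e1.add e2) (by exact e3.add e4), integral_add e1 e2, integral_add e3 e4,
          i1, i2, integral_prod_mul, integral_prod_mul]
        ring

/-- The covariance kernel of the indicators `1{· ≤ s}` under `P`. -/
noncomputable def covKernel (P : Measure ℝ) (s t : ℝ) : ℝ :=
  (P (Iic (min s t))).toReal - (P (Iic s)).toReal * (P (Iic t)).toReal

theorem integral_stepDiff_mul (P : Measure ℝ) [IsProbabilityMeasure P] (s t : ℝ) :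
    ∫ q, stepDiff s q * stepDiff t q ∂(P.prod P) = 2 * covKernel P s t := by
  have hI (r : ℝ) : Integrable ((Iic r).indicator (1 : ℝ → ℝ)) P :=
    (integrable_const (1 : ℝ)).indicator measurableSet_Iic
  have hmul : (fun u => (Iic s).indicator (1 : ℝ → ℝ) u * (Iic t).indicator (1 : ℝ → ℝ) u) =
      (Iic (min s t)).indicator (1 : ℝ → ℝ) := by
    rw [← Iic_inter_Iic, inter_indicator_one]
    rfl
  have := integral_prod_sub_mul_sub P (hI s) (hI t) (by rw [hmul]; exact hI _)
  rw [hmul] at this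
  simpa only [integral_indicator_one measurableSet_Iic, Measure.real, stepDiff, covKernel] using this

theorem covKernel_nonneg (P : Measure ℝ) [IsProbabilityMeasure P] (s t : ℝ) :
    0 ≤ covKernel P s t := by
  have h := integral_stepDiff_mul P s t
  have : 0 ≤ ∫ q, stepDiff s q * stepDiff t q ∂(P.prod P) :=
    integral_nonneg fun q => stepDiff_mul_nonneg s t q
  linarith

/-- Hoeffding's covariance identity for functions whose increments are integrals of step
functions. -/
theorem covariance_eq_integral_covKernel (P ν₁ ν₂ : Measure ℝ) [IsProbabilityMeasure P]
    [SFinite ν₁] [SFinite ν₂] {X Y f g : ℝ → ℝ}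
    (hf : Measurable f) (hg : Measurable g)
    (hX : Integrable X P) (hY : Integrable Y P) (hXY : Integrable (fun u => X u * Y u) P)
    (hfX : ∀ q : ℝ × ℝ, X q.1 - X q.2 = -∫ s, f s * stepDiff s q ∂ν₁)
    (hgY : ∀ q : ℝ × ℝ, Y q.1 - Y q.2 = -∫ t, g t * stepDiff t q ∂ν₂)
    (hint : Integrable (fun p : ℝ × ℝ => f p.1 * covKernel P p.1 p.2 * g p.2) (ν₁.prod ν₂)) :
    (∫ u, X u * Y u ∂P) - (∫ u, X u ∂P) * ∫ u, Y u ∂P =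
      ∫ p, f p.1 * covKernel P p.1 p.2 * g p.2 ∂(ν₁.prod ν₂) := by
  let Φ : (ℝ × ℝ) × (ℝ × ℝ) → ℝ := fun z =>
    (f z.1.1 * g z.1.2) * (stepDiff z.1.1 z.2 * stepDiff z.1.2 z.2)
  have hΦ : Measurable Φ := by
    have a1 : Measurable fun z : (ℝ × ℝ) × (ℝ × ℝ) => stepDiff z.1.1 z.2 :=
      measurable_stepDiff_uncurry.comp (by fun_prop : Measurable
        fun z : (ℝ × ℝ) × (ℝ × ℝ) => (z.1.1, z.2))
    have a2 : Measurable fun z : (ℝ × ℝ) × (ℝ × ℝ) => stepDiff z.1.2 z.2 :=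
      measurable_stepDiff_uncurry.comp (by fun_prop : Measurable
        fun z : (ℝ × ℝ) × (ℝ × ℝ) => (z.1.2, z.2))
    exact ((hf.comp (by fun_prop)).mul (hg.comp (by fun_prop))).mul (a1.mul a2)
  have hstep (s t : ℝ) :
      Integrable (fun q => stepDiff s q * stepDiff t q) (P.prod P) := by
    refine Integrable.of_bound (C := 1) ?_ (ae_of_all _ (abs_stepDiff_mul_le_one s t))
    exact ((measurable_stepDiff_uncurry.comp measurable_prodMk_left).mul
      (measurable_stepDiff_uncurry.comp measurable_prodMk_left)).aestronglyMeasurable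
  have hΦi : Integrable Φ ((ν₁.prod ν₂).prod (P.prod P)) := by
    rw [integrable_prod_iff hΦ.aestronglyMeasurable]
    refine ⟨ae_of_all _ fun p => (hstep p.1 p.2).const_mul (f p.1 * g p.2), ?_⟩
    refine (hint.norm.const_mul 2).congr (ae_of_all _ fun p => ?_)
    simp only [Φ, norm_mul (f p.1 * g p.2), integral_const_mul]
    have : ∀ q, ‖stepDiff p.1 q * stepDiff p.2 q‖ = stepDiff p.1 q * stepDiff p.2 q :=
      fun q => Real.norm_of_nonneg (stepDiff_mul_nonneg _ _ q)
    simp only [this, integral_stepDiff_mul, norm_mul,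
      Real.norm_of_nonneg (covKernel_nonneg P p.1 p.2)]
    ring
  have key := integral_integral_swap (f := fun p q => Φ (p, q)) hΦi
  have hl : ∀ p : ℝ × ℝ, ∫ q, Φ (p, q) ∂(P.prod P) =
      2 * (f p.1 * covKernel P p.1 p.2 * g p.2) := by
    intro p
    simp only [Φ, integral_const_mul, integral_stepDiff_mul]
    ring
  have hr : ∀ q : ℝ × ℝ, ∫ p, Φ (p, q) ∂(ν₁.prod ν₂) =
      (X q.1 - X q.2) * (Y q.1 - Y q.2) := by
    intro q
    rw [hfX, hgY, neg_mul_neg, ← integral_prod_mul]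
    congr 1
    ext p
    simp only [Φ]
    ring
  simp only [hl, hr, integral_const_mul, integral_prod_sub_mul_sub P hX hY hXY] at key
  linarith

theorem HasAEDeriv.sub_eq_neg_integral_stepDiff {h h' : ℝ → ℝ} (hh : HasAEDeriv h h')
    (q : ℝ × ℝ) : h q.1 - h q.2 = -∫ t, h' t * stepDiff t q := by
  have ordered : ∀ u w : ℝ, w ≤ u → h u - h w = -∫ t, h' t * stepDiff t (u, w) := by
    intro u w hwu
    rw [(hh w u).2, intervalIntegral.integral_of_le hwu, ← integral_Ico_eq_integral_Ioc,
      ← integral_indicator measurableSet_Ico, ← integral_neg]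
    congr 1
    ext t
    simp only [stepDiff, indicator, mem_Iic, mem_Ico, Pi.one_apply]
    split_ifs <;> first | (exfalso; grind) | simp
  obtain ⟨u, w⟩ := q
  rcases le_total w u with hwu | huw
  · exact ordered u w hwu
  · have hsw : ∀ t, stepDiff t (u, w) = -stepDiff t (w, u) := fun t => by simp [stepDiff]
    have := ordered w u huw
    simp only [hsw, mul_neg, integral_neg]
    linarith

theorem HasAEDeriv.sub_eq_neg_integral_gaussianReal {h h' : ℝ → ℝ} (hh : HasAEDeriv h h')
    (m : ℝ) {v : ℝ≥0} (hv : v ≠ 0) (q : ℝ × ℝ) :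
    h q.1 - h q.2 =
      -∫ t, h' t / gaussianPDFReal m v t * stepDiff t q ∂(gaussianReal m v) := by
  rw [hh.sub_eq_neg_integral_stepDiff, integral_gaussianReal_eq_integral_smul hv]
  congr 2
  ext t
  have := (gaussianPDFReal_pos m v t hv).ne'
  simp only [smul_eq_mul]
  field_simp

/-- Saumard's lemma for the Gaussian `N(m, σ²)`: (i) the kernel `K_γ` is nonnegative;
(ii) `−L_γ h(x) = E[h'(N) K_γ(N,x)/(γ(N)γ(x))]`;
(iii) `Cov[h(N), g(N)] = E[h'(N₁) (K_γ(N₁,N₂)/(γ(N₁)γ(N₂))) g'(N₂)]`. -/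
theorem saumard_lemma (m σ : ℝ) (hσ : 0 < σ) :
    (∀ x x' : ℝ, 0 ≤ gaussK m ((σ ^ 2).toNNReal) x x') ∧
    (∀ h h' : ℝ → ℝ, Measurable h → Measurable h' → HasAEDeriv h h' →
      Integrable h (gaussianReal m ((σ ^ 2).toNNReal)) →
      ∀ x : ℝ,
        Integrable
          (fun n => |h' n| * gaussK m ((σ ^ 2).toNNReal) n x /
            gaussianPDFReal m ((σ ^ 2).toNNReal) n)
          (gaussianReal m ((σ ^ 2).toNNReal)) →
        -(gaussL m ((σ ^ 2).toNNReal) h x) =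
          ∫ n, h' n * gaussK m ((σ ^ 2).toNNReal) n x /
              (gaussianPDFReal m ((σ ^ 2).toNNReal) n *
                gaussianPDFReal m ((σ ^ 2).toNNReal) x)
            ∂(gaussianReal m ((σ ^ 2).toNNReal))) ∧
    (∀ h h' g g' : ℝ → ℝ, Measurable h → Measurable h' → Measurable g → Measurable g' →
      HasAEDeriv h h' → HasAEDeriv g g' →
      Integrable (fun x => h x ^ 2) (gaussianReal m ((σ ^ 2).toNNReal)) →
      Integrable (fun x => g x ^ 2) (gaussianReal m ((σ ^ 2).toNNReal)) →
      Integrable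
        (fun q : ℝ × ℝ => h' q.1 *
          (gaussK m ((σ ^ 2).toNNReal) q.1 q.2 /
            (gaussianPDFReal m ((σ ^ 2).toNNReal) q.1 *
              gaussianPDFReal m ((σ ^ 2).toNNReal) q.2)) * g' q.2)
        ((gaussianReal m ((σ ^ 2).toNNReal)).prod (gaussianReal m ((σ ^ 2).toNNReal))) →
      (∫ x, h x * g x ∂(gaussianReal m ((σ ^ 2).toNNReal))) -
          (∫ x, h x ∂(gaussianReal m ((σ ^ 2).toNNReal))) *
            (∫ x, g x ∂(gaussianReal m ((σ ^ 2).toNNReal))) =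
        ∫ q : ℝ × ℝ, h' q.1 *
            (gaussK m ((σ ^ 2).toNNReal) q.1 q.2 /
              (gaussianPDFReal m ((σ ^ 2).toNNReal) q.1 *
                gaussianPDFReal m ((σ ^ 2).toNNReal) q.2)) * g' q.2
          ∂((gaussianReal m ((σ ^ 2).toNNReal)).prod
              (gaussianReal m ((σ ^ 2).toNNReal)))) := by
  have hv : (σ ^ 2).toNNReal ≠ 0 := (Real.toNNReal_pos.2 (by positivity)).ne'
  generalize (σ ^ 2).toNNReal = v at hv
  have hpdf := measurable_gaussianPDFReal m v
  refine ⟨covKernel_nonneg _, ?_, ?_⟩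
  · intro h h' _ hh' hh hi x hint
    have hx := (gaussianPDFReal_pos m v x hv).ne'
    have hInd : Integrable ((Iic x).indicator (1 : ℝ → ℝ)) (gaussianReal m v) :=
      (integrable_const (1 : ℝ)).indicator measurableSet_Iic
    have hmul : (fun u => h u * -(Iic x).indicator (1 : ℝ → ℝ) u) =
        fun u => -(Iic x).indicator h u := by
      ext u
      by_cases hu : u ∈ Iic x <;> simp [hu]
    have hemb : MeasurableEmbedding fun s : ℝ => (s, x) := measurableEmbedding_prod_mk_right x
    have key := covariance_eq_integral_covKernel (gaussianReal m v) (gaussianReal m v)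
      (Measure.dirac x) (X := h) (Y := fun u => -(Iic x).indicator (1 : ℝ → ℝ) u)
      (f := fun t => h' t / gaussianPDFReal m v t) (g := fun _ => 1)
      (hh'.div hpdf) measurable_const hi hInd.neg
      (by rw [hmul]; exact (hi.indicator measurableSet_Iic).neg)
      (hh.sub_eq_neg_integral_gaussianReal m hv)
      (fun q => by simp only [one_mul, integral_dirac, stepDiff]; ring)
      (by
        rw [Measure.prod_dirac, hemb.integrable_map_iff]
        have hK : Measurable fun n => gaussK m v n x := by
          have hF : Measurable fun n => ((gaussianReal m v) (Iic n)).toReal :=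
            (Monotone.measurable fun a b hab => measure_mono (Iic_subset_Iic.2 hab)).ennreal_toReal
          exact (hF.comp (measurable_id.min measurable_const)).sub (hF.mul_const _)
        refine hint.mono' ((((hh'.div hpdf).mul hK).mul_const 1).aestronglyMeasurable)
          (ae_of_all _ fun n => le_of_eq ?_)
        have h1 : 0 ≤ gaussK m v n x := covKernel_nonneg _ n x
        have h2 := gaussianPDFReal_nonneg m v n
        change |h' n / gaussianPDFReal m v n * gaussK m v n x * 1| = _
        rw [mul_one, abs_mul, abs_div, abs_of_nonneg h1, abs_of_nonneg h2]
        ring)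
    rw [hmul, Measure.prod_dirac, hemb.integral_map, integral_neg, integral_neg,
      integral_indicator measurableSet_Iic, integral_indicator_one measurableSet_Iic] at key
    have hL : gaussL m v h x = ((∫ u in Iic x, h u ∂(gaussianReal m v)) -
        (gaussianReal m v).real (Iic x) * ∫ y, h y ∂(gaussianReal m v)) /
          gaussianPDFReal m v x := by
      rw [gaussL, integral_sub hi.integrableOn (integrable_const _), setIntegral_const, smul_eq_mul]
    have hR : ∀ n, h' n * gaussK m v n x / (gaussianPDFReal m v n * gaussianPDFReal m v x) =
        (h' n / gaussianPDFReal m v n * covKernel (gaussianReal m v) n x * 1) /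
          gaussianPDFReal m v x := by
      intro n
      have : covKernel (gaussianReal m v) n x = gaussK m v n x := rfl
      rw [this]
      ring
    simp only [hR, integral_div]
    rw [← key, hL]
    ring
  · intro h h' g g' hmh hh' hmg hg' hh hg hi gi hint
    have hh2 : MemLp h 2 (gaussianReal m v) :=
      (memLp_two_iff_integrable_sq hmh.aestronglyMeasurable).2 hi
    have hg2 : MemLp g 2 (gaussianReal m v) :=
      (memLp_two_iff_integrable_sq hmg.aestronglyMeasurable).2 gi
    have hR : ∀ q : ℝ × ℝ, h' q.1 * (gaussK m v q.1 q.2 /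
        (gaussianPDFReal m v q.1 * gaussianPDFReal m v q.2)) * g' q.2 =
        h' q.1 / gaussianPDFReal m v q.1 * covKernel (gaussianReal m v) q.1 q.2 *
          (g' q.2 / gaussianPDFReal m v q.2) := by
      intro q
      have : covKernel (gaussianReal m v) q.1 q.2 = gaussK m v q.1 q.2 := rfl
      rw [this]
      ring
    simp only [hR] at hint ⊢
    exact covariance_eq_integral_covKernel _ _ _ (hh'.div hpdf) (hg'.div hpdf)
      (hh2.integrable one_le_two) (hg2.integrable one_le_two) (hh2.integrable_mul hg2)
      (hh.sub_eq_neg_integral_gaussianReal m hv) (hg.sub_eq_neg_integral_gaussianReal m hv) hint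
end

section
/- (Klaassen lower variance bound, continuous case.) Let p be a probability density on ℝ positive exactly on the open interval S = (a, b), and let X have density p. Let c : S → ℝ be such that cp is locally absolutely continuous on S with c(x)p(x) → 0 as x → a⁺ and x → b⁻, and with 0 < E[((cp)'(X)/p(X))²] < ∞. Then for every locally absolutely continuous f with E[f(X)²] < ∞ and E[|c(X) f'(X)|] < ∞: Var[f(X)] ≥ (E[c(X) f'(X)])² / E[((cp)'(X)/p(X))²], with equality if and only if there exist real numbers α, β with f(x) = α (cp)'(x)/p(x) + β for a.e. x ∈ S. -/
open MeasureTheory Set Filter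

/-- `h` is locally absolutely continuous on `S` with a.e. derivative `h'`,
expressed through the fundamental theorem of calculus. -/
def LocAC (S : Set ℝ) (h h' : ℝ → ℝ) : Prop :=
  ∀ x ∈ S, ∀ y ∈ S, IntervalIntegrable h' MeasureTheory.volume x y ∧
    h y - h x = ∫ t in x..y, h' t


theorem LocAC.continuousOn_uIcc {S : Set ℝ} {f f' : ℝ → ℝ} (hS : S.OrdConnected)
    (hf : LocAC S f f') {x y : ℝ} (hx : x ∈ S) (hy : y ∈ S) : ContinuousOn f (uIcc x y) := by
  have hc := ((hf x hx y hy).1.absolutelyContinuousOnInterval_intervalIntegral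
    left_mem_uIcc).continuousOn
  refine (continuousOn_const.add hc : ContinuousOn (fun t => f x + ∫ v in x..t, f' v) _).congr ?_
  intro t ht
  have := (hf x hx t (hS.uIcc_subset hx hy ht)).2
  change f t = f x + ∫ v in x..t, f' v
  linarith

theorem LocAC.mul {S : Set ℝ} {f f' g g' : ℝ → ℝ} (hS : S.OrdConnected)
    (hf : LocAC S f f') (hg : LocAC S g g') :
    LocAC S (fun x => f x * g x) (fun x => f' x * g x + f x * g' x) := by
  intro x hx y hy
  obtain ⟨hfi, -⟩ := hf x hx y hy
  obtain ⟨hgi, -⟩ := hg x hx y hy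
  have hsub := hS.uIcc_subset hx hy
  refine ⟨(hfi.mul_continuousOn (hg.continuousOn_uIcc hS hx hy)).add
    (hgi.continuousOn_mul (hf.continuousOn_uIcc hS hx hy)), ?_⟩
  have hprim : ∀ {k k' : ℝ → ℝ}, LocAC S k k' → ∀ t ∈ uIcc x y,
      k x + ∫ v in x..t, k' v = k t := fun {k k'} hk t ht => by
    have := (hk x hx t (hsub ht)).2
    linarith
  have hac : ∀ {k k' : ℝ → ℝ}, IntervalIntegrable k' volume x y →
      AbsolutelyContinuousOnInterval (fun t => k x + ∫ v in x..t, k' v) x y := fun {k k'} hk =>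
    ((LipschitzWith.const (k x)).lipschitzOnWith.absolutelyContinuousOnInterval).fun_add
      (hk.absolutelyContinuousOnInterval_intervalIntegral left_mem_uIcc)
  have key := (hac (k := f) hfi).integral_deriv_mul_eq_sub (hac (k := g) hgi)
  simp only [hprim hf y right_mem_uIcc, hprim hg y right_mem_uIcc, intervalIntegral.integral_same,
    add_zero] at key
  rw [← key]
  apply intervalIntegral.integral_congr_ae
  filter_upwards [hfi.ae_hasDerivAt_integral, hgi.ae_hasDerivAt_integral] with t hft hgt ht
  have ht' := uIoc_subset_uIcc ht
  rw [((hft ht' x left_mem_uIcc).const_add (f x)).deriv,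
    ((hgt ht' x left_mem_uIcc).const_add (g x)).deriv, hprim hf t ht', hprim hg t ht']

/-- A short-interval Grönwall bound for locally absolutely continuous functions. -/
theorem LocAC.abs_le_two_mul {S : Set ℝ} {f f' k : ℝ → ℝ} (hS : S.OrdConnected)
    (hf : LocAC S f f') {x y : ℝ} (hx : x ∈ S) (hy : y ∈ S) (hk : IntervalIntegrable k volume x y)
    (hk0 : ∀ t ∈ uIcc x y, 0 ≤ k t) (hkf : ∀ t ∈ uIcc x y, |f' t| ≤ k t * |f t|)
    (hk1 : ∫ t in uIoc x y, k t ≤ 1 / 2) : |f y| ≤ 2 * |f x| := by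
  obtain ⟨z, hz, hmax⟩ := isCompact_uIcc.exists_isMaxOn nonempty_uIcc
    (hf.continuousOn_uIcc hS hx hy).abs
  have hsub : uIoc x z ⊆ uIoc x y := uIoc_subset_uIoc_of_uIcc_subset_uIcc (uIcc_subset_uIcc_left hz)
  obtain ⟨hfi, hfz⟩ := hf x hx z (hS.uIcc_subset hx hy hz)
  have hki : IntegrableOn k (uIoc x y) := intervalIntegrable_iff.1 hk
  have hbound : |f z - f x| ≤ |f z| * (1 / 2) := by
    rw [hfz]
    calc |∫ t in x..z, f' t| ≤ ∫ t in uIoc x z, |f' t| :=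
          intervalIntegral.norm_integral_le_integral_norm_uIoc (f := f')
      _ ≤ ∫ t in uIoc x z, |f z| * k t := by
          refine setIntegral_mono_on (intervalIntegrable_iff.1 hfi).abs
            ((hki.mono_set hsub).const_mul _) measurableSet_uIoc fun t ht => ?_
          have ht' := uIoc_subset_uIcc (hsub ht)
          calc |f' t| ≤ k t * |f t| := hkf t ht'
            _ ≤ k t * |f z| := mul_le_mul_of_nonneg_left (hmax ht') (hk0 t ht')
            _ = |f z| * k t := mul_comm _ _
      _ = |f z| * ∫ t in uIoc x z, k t := integral_const_mul _ _
      _ ≤ |f z| * ∫ t in uIoc x y, k t := by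
          refine mul_le_mul_of_nonneg_left (setIntegral_mono_set hki ?_
            hsub.eventuallyLE) (abs_nonneg _)
          exact (ae_restrict_iff' measurableSet_uIoc).2
            (Eventually.of_forall fun t ht => hk0 t (uIoc_subset_uIcc ht))
      _ ≤ |f z| * (1 / 2) := mul_le_mul_of_nonneg_left hk1 (abs_nonneg _)
  have h1 : |f y| ≤ |f z| := hmax right_mem_uIcc
  have h2 : |f z| - |f x| ≤ |f z - f x| := abs_sub_abs_le_abs_sub _ _
  linarith

/-- If `u → 0` along `l`, `u * f` converges along `l` and the primitive of `|u * f'|`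
converges along `l`, then `u * f → 0` along `l`. -/
theorem LocAC.mul_limit_eq_zero {S : Set ℝ} {f f' u : ℝ → ℝ} {l : Filter ℝ} [l.NeBot]
    (hS : S.OrdConnected) (hSl : S ∈ l) (hl : ∀ T ∈ l, ∃ T' ∈ l, T' ⊆ T ∧ T'.OrdConnected)
    (hf : LocAC S f f') (hu : Tendsto u l (nhds 0))
    (hv : IntegrableOn (fun x => u x * f' x) S) {x₀ A L : ℝ} (hx₀ : x₀ ∈ S)
    (hA : Tendsto (fun y => ∫ t in x₀..y, |u t * f' t|) l (nhds A))
    (hL : Tendsto (fun y => u y * f y) l (nhds L)) : L = 0 := by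
  by_contra hL0
  have hLpos : 0 < |L| := abs_pos.2 hL0
  have hvi : ∀ {x y}, x ∈ S → y ∈ S → IntervalIntegrable (fun t => |u t * f' t|) volume x y :=
    fun hx hy => intervalIntegrable_iff.2
      (IntegrableOn.mono_set hv.abs (uIoc_subset_uIcc.trans (hS.uIcc_subset hx hy)))
  have hW : ∀ᶠ y in l, |L| / 2 < |u y * f y| := hL.abs.eventually_const_lt (by linarith)
  have hΦ : ∀ᶠ y in l, |(∫ t in x₀..y, |u t * f' t|) - A| < |L| / 8 :=
    hA.eventually (Metric.ball_mem_nhds A (by positivity : 0 < |L| / 8))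
  obtain ⟨T, hT, hTsub, hTord⟩ := hl _ (inter_mem hSl (inter_mem hW hΦ))
  obtain ⟨x, hx⟩ := Filter.nonempty_of_mem hT
  have hbdd : ∀ y ∈ T, |f y| ≤ 2 * |f x| := by
    intro y hy
    obtain ⟨hxS, -, hxΦ⟩ := hTsub hx
    obtain ⟨hyS, -, hyΦ⟩ := hTsub hy
    refine hf.abs_le_two_mul hS (k := fun t => 2 / |L| * |u t * f' t|) hxS hyS
      ((hvi hxS hyS).const_mul _) (fun t _ => by positivity) ?_ ?_
    · intro t ht
      have hWt : |L| / 2 < |u t * f t| := (hTsub (hTord.uIcc_subset hx hy ht)).2.1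
      rw [abs_mul] at hWt ⊢
      have : 2 / |L| * (|u t| * |f' t|) * |f t| = (|u t| * |f t|) / (|L| / 2) * |f' t| := by
        field_simp
      rw [this]
      refine le_mul_of_one_le_left (abs_nonneg _) ?_
      rw [one_le_div (by positivity)]
      exact hWt.le
    · rw [integral_const_mul]
      have hdiff : (∫ t in x..y, |u t * f' t|) =
          (∫ t in x₀..y, |u t * f' t|) - ∫ t in x₀..x, |u t * f' t| :=
        (intervalIntegral.integral_interval_sub_left (hvi hx₀ hyS) (hvi hx₀ hxS)).symm
      have hle : ∫ t in uIoc x y, |u t * f' t| ≤ |L| / 4 := by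
        refine (le_abs_self _).trans ?_
        rw [← intervalIntegral.abs_integral_eq_abs_integral_uIoc, hdiff]
        change |_ - A| < _ at hxΦ
        change |_ - A| < _ at hyΦ
        rw [abs_lt] at hxΦ hyΦ
        rw [abs_le]
        constructor <;> linarith [hxΦ.1, hxΦ.2, hyΦ.1, hyΦ.2]
      calc 2 / |L| * ∫ t in uIoc x y, |u t * f' t| ≤ 2 / |L| * (|L| / 4) :=
            mul_le_mul_of_nonneg_left hle (by positivity)
        _ = 1 / 2 := by field_simp; norm_num
  have hzero : Tendsto (fun y => u y * f y) l (nhds 0) := by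
    refine squeeze_zero_norm' (a := fun y => |u y| * (2 * |f x|)) ?_ ?_
    · filter_upwards [hT] with y hy
      rw [Real.norm_eq_abs, abs_mul]
      exact mul_le_mul_of_nonneg_left (hbdd y hy) (abs_nonneg _)
    · simpa using hu.abs.mul_const (2 * |f x|)
  exact hL0 (tendsto_nhds_unique hL hzero)

section Endpoints

variable {a b : EReal}

theorem ordConnected_setOf_coe_mem_Ioo (a b : EReal) :
    {x : ℝ | a < (x : EReal) ∧ (x : EReal) < b}.OrdConnected :=
  ⟨fun _ hx _ hy _ hz => ⟨hx.1.trans_le (EReal.coe_le_coe_iff.2 hz.1),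
    (EReal.coe_le_coe_iff.2 hz.2).trans_lt hy.2⟩⟩

theorem measurableSet_setOf_coe_mem_Ioo (a b : EReal) :
    MeasurableSet {x : ℝ | a < (x : EReal) ∧ (x : EReal) < b} :=
  measurable_coe_real_ereal measurableSet_Ioo

theorem mem_comap_coe_nhdsLT_iff (hab : a < b) {T : Set ℝ} :
    T ∈ comap (fun x : ℝ => (x : EReal)) (nhdsWithin b (Iio b)) ↔
      ∃ t : ℝ, a < (t : EReal) ∧ (t : EReal) < b ∧
        {x : ℝ | (t : EReal) < x ∧ (x : EReal) < b} ⊆ T := by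
  rw [mem_comap]
  constructor
  · rintro ⟨U, hU, hUT⟩
    obtain ⟨s, hs, hsU⟩ := (mem_nhdsLT_iff_exists_Ioo_subset' hab).1 hU
    obtain ⟨t, ht₁, ht₂⟩ := EReal.lt_iff_exists_real_btwn.1 (max_lt hab hs)
    exact ⟨t, (le_max_left _ _).trans_lt ht₁, ht₂, fun x hx => hUT (hsU
      ⟨((le_max_right _ _).trans_lt ht₁).trans hx.1, hx.2⟩)⟩
  · rintro ⟨t, -, htb, hT⟩
    exact ⟨Ioo t b, Ioo_mem_nhdsLT htb, hT⟩

theorem mem_comap_coe_nhdsGT_iff (hab : a < b) {T : Set ℝ} :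
    T ∈ comap (fun x : ℝ => (x : EReal)) (nhdsWithin a (Ioi a)) ↔
      ∃ t : ℝ, a < (t : EReal) ∧ (t : EReal) < b ∧
        {x : ℝ | a < (x : EReal) ∧ (x : EReal) < t} ⊆ T := by
  rw [mem_comap]
  constructor
  · rintro ⟨U, hU, hUT⟩
    obtain ⟨s, hs, hsU⟩ := (mem_nhdsGT_iff_exists_Ioo_subset' hab).1 hU
    obtain ⟨t, ht₁, ht₂⟩ := EReal.lt_iff_exists_real_btwn.1 (lt_min hab hs)
    exact ⟨t, ht₁, ht₂.trans_le (min_le_left _ _), fun x hx => hUT (hsU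
      ⟨hx.1, hx.2.trans (ht₂.trans_le (min_le_right _ _))⟩)⟩
  · rintro ⟨t, hta, -, hT⟩
    exact ⟨Ioo a t, Ioo_mem_nhdsGT hta, hT⟩

theorem comap_coe_nhdsLT_neBot (hab : a < b) :
    (comap (fun x : ℝ => (x : EReal)) (nhdsWithin b (Iio b))).NeBot := by
  refine forall_mem_nonempty_iff_neBot.1 fun T hT => ?_
  obtain ⟨t, -, htb, hT⟩ := (mem_comap_coe_nhdsLT_iff hab).1 hT
  obtain ⟨x, hx⟩ := EReal.lt_iff_exists_real_btwn.1 htb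
  exact ⟨x, hT hx⟩

theorem comap_coe_nhdsGT_neBot (hab : a < b) :
    (comap (fun x : ℝ => (x : EReal)) (nhdsWithin a (Ioi a))).NeBot := by
  refine forall_mem_nonempty_iff_neBot.1 fun T hT => ?_
  obtain ⟨t, hta, -, hT⟩ := (mem_comap_coe_nhdsGT_iff hab).1 hT
  obtain ⟨x, hx⟩ := EReal.lt_iff_exists_real_btwn.1 hta
  exact ⟨x, hT hx⟩

theorem tendsto_intervalIntegral_comap_coe_nhdsLT (hab : a < b) {h : ℝ → ℝ}
    (hh : IntegrableOn h {x : ℝ | a < (x : EReal) ∧ (x : EReal) < b}) {x₀ : ℝ}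
    (hx₀ : a < (x₀ : EReal) ∧ (x₀ : EReal) < b) :
    Tendsto (fun y => ∫ t in x₀..y, h t)
      (comap (fun x : ℝ => (x : EReal)) (nhdsWithin b (Iio b)))
      (nhds (∫ t in {x : ℝ | a < (x : EReal) ∧ (x : EReal) < b} ∩ Ioi x₀, h t)) := by
  have hSm := (measurableSet_setOf_coe_mem_Ioo a b).inter (measurableSet_Ioi (a := x₀))
  have hcov : AECover (volume.restrict ({x : ℝ | a < (x : EReal) ∧ (x : EReal) < b} ∩ Ioi x₀))
      (comap (fun x : ℝ => (x : EReal)) (nhdsWithin b (Iio b))) (fun y => Ioc x₀ y) := by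
    refine ⟨(ae_restrict_iff' hSm).2 (Eventually.of_forall fun x hx => ?_),
      fun _ => measurableSet_Ioc⟩
    exact (mem_comap_coe_nhdsLT_iff hab).2 ⟨x, hx.1.1, hx.1.2,
      fun y hy => ⟨hx.2, (EReal.coe_lt_coe_iff.1 hy.1).le⟩⟩
  refine (hcov.integral_tendsto_of_countably_generated (hh.mono_set inter_subset_left)).congr' ?_
  refine (mem_comap_coe_nhdsLT_iff hab).2 ⟨x₀, hx₀.1, hx₀.2, fun y hy => ?_⟩
  have hy' : x₀ ≤ y := (EReal.coe_lt_coe_iff.1 hy.1).le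
  change ∫ t in Ioc x₀ y, h t ∂_ = ∫ t in x₀..y, h t
  rw [intervalIntegral.integral_of_le hy', Measure.restrict_restrict measurableSet_Ioc,
    inter_eq_left.2]
  exact fun t ht => ⟨(ordConnected_setOf_coe_mem_Ioo a b).out hx₀
    ⟨hx₀.1.trans hy.1, hy.2⟩ ⟨ht.1.le, ht.2⟩, ht.1⟩

theorem tendsto_intervalIntegral_comap_coe_nhdsGT (hab : a < b) {h : ℝ → ℝ}
    (hh : IntegrableOn h {x : ℝ | a < (x : EReal) ∧ (x : EReal) < b}) {x₀ : ℝ}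
    (hx₀ : a < (x₀ : EReal) ∧ (x₀ : EReal) < b) :
    Tendsto (fun y => ∫ t in x₀..y, h t)
      (comap (fun x : ℝ => (x : EReal)) (nhdsWithin a (Ioi a)))
      (nhds (-∫ t in {x : ℝ | a < (x : EReal) ∧ (x : EReal) < b} \ Ioi x₀, h t)) := by
  have hSm := (measurableSet_setOf_coe_mem_Ioo a b).diff (measurableSet_Ioi (a := x₀))
  have hcov : AECover (volume.restrict ({x : ℝ | a < (x : EReal) ∧ (x : EReal) < b} \ Ioi x₀))
      (comap (fun x : ℝ => (x : EReal)) (nhdsWithin a (Ioi a))) (fun y => Ioc y x₀) := by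
    refine ⟨(ae_restrict_iff' hSm).2 (Eventually.of_forall fun x hx => ?_),
      fun _ => measurableSet_Ioc⟩
    exact (mem_comap_coe_nhdsGT_iff hab).2 ⟨x, hx.1.1, hx.1.2,
      fun y hy => ⟨EReal.coe_lt_coe_iff.1 hy.2, not_lt.1 hx.2⟩⟩
  refine (hcov.integral_tendsto_of_countably_generated
    (hh.mono_set sdiff_subset)).neg.congr' ?_
  refine (mem_comap_coe_nhdsGT_iff hab).2 ⟨x₀, hx₀.1, hx₀.2, fun y hy => ?_⟩
  have hy' : y ≤ x₀ := (EReal.coe_lt_coe_iff.1 hy.2).le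
  change -∫ t in Ioc y x₀, h t ∂_ = ∫ t in x₀..y, h t
  rw [intervalIntegral.integral_of_ge hy', Measure.restrict_restrict measurableSet_Ioc,
    inter_eq_left.2]
  exact fun t ht => ⟨(ordConnected_setOf_coe_mem_Ioo a b).out
    ⟨hy.1, hy.2.trans hx₀.2⟩ hx₀ ⟨ht.1.le, ht.2⟩, not_lt.2 ht.2⟩

theorem LocAC.tendsto_comap_coe_nhdsLT (hab : a < b) {W g : ℝ → ℝ}
    (hW : LocAC {x : ℝ | a < (x : EReal) ∧ (x : EReal) < b} W g)
    (hg : IntegrableOn g {x : ℝ | a < (x : EReal) ∧ (x : EReal) < b}) {x₀ : ℝ}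
    (hx₀ : a < (x₀ : EReal) ∧ (x₀ : EReal) < b) :
    Tendsto W (comap (fun x : ℝ => (x : EReal)) (nhdsWithin b (Iio b)))
      (nhds (W x₀ + ∫ t in {x : ℝ | a < (x : EReal) ∧ (x : EReal) < b} ∩ Ioi x₀, g t)) := by
  refine ((tendsto_intervalIntegral_comap_coe_nhdsLT hab hg hx₀).const_add (W x₀)).congr' ?_
  refine (mem_comap_coe_nhdsLT_iff hab).2 ⟨x₀, hx₀.1, hx₀.2, fun y hy => ?_⟩
  have := (hW x₀ hx₀ y ⟨hx₀.1.trans hy.1, hy.2⟩).2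
  change W x₀ + ∫ t in x₀..y, g t = W y
  linarith

theorem LocAC.tendsto_comap_coe_nhdsGT (hab : a < b) {W g : ℝ → ℝ}
    (hW : LocAC {x : ℝ | a < (x : EReal) ∧ (x : EReal) < b} W g)
    (hg : IntegrableOn g {x : ℝ | a < (x : EReal) ∧ (x : EReal) < b}) {x₀ : ℝ}
    (hx₀ : a < (x₀ : EReal) ∧ (x₀ : EReal) < b) :
    Tendsto W (comap (fun x : ℝ => (x : EReal)) (nhdsWithin a (Ioi a)))
      (nhds (W x₀ + -∫ t in {x : ℝ | a < (x : EReal) ∧ (x : EReal) < b} \ Ioi x₀, g t)) := by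
  refine ((tendsto_intervalIntegral_comap_coe_nhdsGT hab hg hx₀).const_add (W x₀)).congr' ?_
  refine (mem_comap_coe_nhdsGT_iff hab).2 ⟨x₀, hx₀.1, hx₀.2, fun y hy => ?_⟩
  have := (hW x₀ hx₀ y ⟨hy.1, hy.2.trans hx₀.2⟩).2
  change W x₀ + ∫ t in x₀..y, g t = W y
  linarith

/-- The derivative of a function vanishing at both endpoints has zero integral. -/
theorem LocAC.setIntegral_eq_zero (hab : a < b) {W g : ℝ → ℝ}
    (hW : LocAC {x : ℝ | a < (x : EReal) ∧ (x : EReal) < b} W g)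
    (hg : IntegrableOn g {x : ℝ | a < (x : EReal) ∧ (x : EReal) < b})
    (hWa : Tendsto W (comap (fun x : ℝ => (x : EReal)) (nhdsWithin a (Ioi a))) (nhds 0))
    (hWb : Tendsto W (comap (fun x : ℝ => (x : EReal)) (nhdsWithin b (Iio b))) (nhds 0)) :
    ∫ t in {x : ℝ | a < (x : EReal) ∧ (x : EReal) < b}, g t = 0 := by
  obtain ⟨x₀, hx₀⟩ := EReal.lt_iff_exists_real_btwn.1 hab
  have := comap_coe_nhdsGT_neBot hab
  have := comap_coe_nhdsLT_neBot hab
  have hA := tendsto_nhds_unique (hW.tendsto_comap_coe_nhdsGT hab hg hx₀) hWa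
  have hB := tendsto_nhds_unique (hW.tendsto_comap_coe_nhdsLT hab hg hx₀) hWb
  rw [← integral_inter_add_sdiff (measurableSet_Ioi (a := x₀)) hg]
  linarith

/-- Integration by parts on `(a, b)` with one factor vanishing at the endpoints; the boundary
terms vanish automatically when both integrands are integrable. -/
theorem LocAC.setIntegral_mul_add_mul_eq_zero (hab : a < b) {u d f f' : ℝ → ℝ}
    (hu : LocAC {x : ℝ | a < (x : EReal) ∧ (x : EReal) < b} u d)
    (hf : LocAC {x : ℝ | a < (x : EReal) ∧ (x : EReal) < b} f f')
    (hua : Tendsto u (comap (fun x : ℝ => (x : EReal)) (nhdsWithin a (Ioi a))) (nhds 0))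
    (hub : Tendsto u (comap (fun x : ℝ => (x : EReal)) (nhdsWithin b (Iio b))) (nhds 0))
    (hdf : IntegrableOn (fun x => d x * f x) {x : ℝ | a < (x : EReal) ∧ (x : EReal) < b})
    (huf : IntegrableOn (fun x => u x * f' x) {x : ℝ | a < (x : EReal) ∧ (x : EReal) < b}) :
    ∫ t in {x : ℝ | a < (x : EReal) ∧ (x : EReal) < b}, (d t * f t + u t * f' t) = 0 := by
  obtain ⟨x₀, hx₀⟩ := EReal.lt_iff_exists_real_btwn.1 hab
  have := comap_coe_nhdsGT_neBot hab
  have := comap_coe_nhdsLT_neBot hab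
  have hS := ordConnected_setOf_coe_mem_Ioo a b
  have hW := hu.mul hS hf
  have hg := hdf.add huf
  have hWa := hW.tendsto_comap_coe_nhdsGT hab hg hx₀
  have hWb := hW.tendsto_comap_coe_nhdsLT hab hg hx₀
  have hLa := hf.mul_limit_eq_zero hS
    ((mem_comap_coe_nhdsGT_iff hab).2 ⟨x₀, hx₀.1, hx₀.2, fun x hx => ⟨hx.1, hx.2.trans hx₀.2⟩⟩)
    (fun T hT => by
      obtain ⟨t, hta, htb, hT⟩ := (mem_comap_coe_nhdsGT_iff hab).1 hT
      exact ⟨_, (mem_comap_coe_nhdsGT_iff hab).2 ⟨t, hta, htb, Subset.rfl⟩, hT,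
        ordConnected_setOf_coe_mem_Ioo a t⟩)
    hua huf hx₀ (tendsto_intervalIntegral_comap_coe_nhdsGT hab huf.abs hx₀) hWa
  have hLb := hf.mul_limit_eq_zero hS
    ((mem_comap_coe_nhdsLT_iff hab).2 ⟨x₀, hx₀.1, hx₀.2, fun x hx => ⟨hx₀.1.trans hx.1, hx.2⟩⟩)
    (fun T hT => by
      obtain ⟨t, hta, htb, hT⟩ := (mem_comap_coe_nhdsLT_iff hab).1 hT
      exact ⟨_, (mem_comap_coe_nhdsLT_iff hab).2 ⟨t, hta, htb, Subset.rfl⟩, hT,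
        ordConnected_setOf_coe_mem_Ioo t b⟩)
    hub huf hx₀ (tendsto_intervalIntegral_comap_coe_nhdsLT hab huf.abs hx₀) hWb
  rw [hLa] at hWa
  rw [hLb] at hWb
  exact hW.setIntegral_eq_zero hab hg hWa hWb

end Endpoints

theorem integrable_mul_mul_of_sq {α : Type*} [MeasurableSpace α] {μ : Measure α} {p g h : α → ℝ}
    (hp : Measurable p) (hp0 : ∀ x, 0 ≤ p x) (hg : Measurable g) (hh : Measurable h)
    (hg2 : Integrable (fun x => g x ^ 2 * p x) μ) (hh2 : Integrable (fun x => h x ^ 2 * p x) μ) :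
    Integrable (fun x => g x * h x * p x) μ := by
  refine (hg2.add hh2).mono' ((hg.mul hh).mul hp).aestronglyMeasurable
    (Eventually.of_forall fun x => ?_)
  rw [Real.norm_eq_abs, abs_mul, abs_of_nonneg (hp0 x), Pi.add_apply, ← add_mul]
  refine mul_le_mul_of_nonneg_right (abs_le.2 ⟨?_, ?_⟩) (hp0 x) <;>
    nlinarith [sq_nonneg (g x + h x), sq_nonneg (g x - h x), sq_nonneg (g x), sq_nonneg (h x)]

/-- The residual of the regression of `f` on a centred score `s`, for the density `p`. -/
theorem integral_sq_residual_mul {α : Type*} [MeasurableSpace α] {μ : Measure α} {p s f : α → ℝ}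
    (hp1 : ∫ x, p x ∂μ = 1) (hp : Integrable p μ) (hsp : Integrable (fun x => s x * p x) μ)
    (hsp0 : ∫ x, s x * p x ∂μ = 0) (hs2 : Integrable (fun x => s x ^ 2 * p x) μ)
    (hfp : Integrable (fun x => f x * p x) μ) (hf2 : Integrable (fun x => f x ^ 2 * p x) μ)
    (hfs : Integrable (fun x => f x * s x * p x) μ) (r m : ℝ) :
    Integrable (fun x => (f x - (r * s x + m)) ^ 2 * p x) μ ∧
    ∫ x, (f x - (r * s x + m)) ^ 2 * p x ∂μ = (∫ x, f x ^ 2 * p x ∂μ)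
      - 2 * r * (∫ x, f x * s x * p x ∂μ) - 2 * m * (∫ x, f x * p x ∂μ)
      + (r ^ 2 * (∫ x, s x ^ 2 * p x ∂μ) + m ^ 2) := by
  have h1 : Integrable (fun x => f x ^ 2 * p x - 2 * r * (f x * s x * p x)) μ :=
    hf2.sub (hfs.const_mul _)
  have h2 : Integrable (fun x => f x ^ 2 * p x - 2 * r * (f x * s x * p x)
      - 2 * m * (f x * p x)) μ := h1.sub (hfp.const_mul _)
  have h3 : Integrable (fun x => r ^ 2 * (s x ^ 2 * p x) + 2 * r * m * (s x * p x)) μ :=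
    (hs2.const_mul _).add (hsp.const_mul _)
  have h4 : Integrable (fun x => r ^ 2 * (s x ^ 2 * p x) + 2 * r * m * (s x * p x)
      + m ^ 2 * p x) μ := h3.add (hp.const_mul _)
  have : ∀ x, (f x - (r * s x + m)) ^ 2 * p x =
      f x ^ 2 * p x - 2 * r * (f x * s x * p x) - 2 * m * (f x * p x)
        + (r ^ 2 * (s x ^ 2 * p x) + 2 * r * m * (s x * p x) + m ^ 2 * p x) := fun x => by ring
  simp_rw [this]
  refine ⟨h2.add h4, ?_⟩
  rw [integral_add h2 h4, integral_sub h1 (hfp.const_mul _), integral_sub hf2 (hfs.const_mul _),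
    integral_add h3 (hp.const_mul _), integral_add (hs2.const_mul _) (hsp.const_mul _)]
  simp only [integral_const_mul, hsp0, hp1]
  ring

/-- Klaassen's lower variance bound, continuous case: for a probability density `p`
positive exactly on the open interval `S = (a,b)`, and `c` with `cp` locally absolutely
continuous on `S` (with derivative `d = (cp)'`) vanishing at the endpoints,
`Var[f(X)] ≥ (E[c(X) f'(X)])² / E[((cp)'(X)/p(X))²]`, with equality iff
`f = α (cp)'/p + β` a.e. on `S` for some reals `α, β`. -/
theorem klaassen_lower_bound_continuous
    (p : ℝ → ℝ) (a b : EReal) (hab : a < b)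
    (hpmeas : Measurable p) (hp0 : ∀ x, 0 ≤ p x)
    (hppos : ∀ x : ℝ, 0 < p x ↔ a < (x : EReal) ∧ (x : EReal) < b)
    (hp1 : ∫ x, p x = 1)
    (c d : ℝ → ℝ) (hcmeas : Measurable c) (hdmeas : Measurable d)
    (hcd : LocAC {x : ℝ | a < (x : EReal) ∧ (x : EReal) < b} (fun x => c x * p x) d)
    (hlima : Tendsto (fun x : ℝ => c x * p x)
      (Filter.comap (fun x : ℝ => (x : EReal)) (nhdsWithin a (Ioi a))) (nhds 0))
    (hlimb : Tendsto (fun x : ℝ => c x * p x)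
      (Filter.comap (fun x : ℝ => (x : EReal)) (nhdsWithin b (Iio b))) (nhds 0))
    (hd2 : Integrable (fun x => (d x / p x) ^ 2 * p x))
    (hd2pos : 0 < ∫ x, (d x / p x) ^ 2 * p x)
    (f f' : ℝ → ℝ) (hfmeas : Measurable f) (hf'meas : Measurable f')
    (hACf : LocAC {x : ℝ | a < (x : EReal) ∧ (x : EReal) < b} f f')
    (hf2 : Integrable (fun x => f x ^ 2 * p x))
    (hcf' : Integrable (fun x => c x * f' x * p x)) :
    (∫ x, f x ^ 2 * p x) - (∫ x, f x * p x) ^ 2 ≥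
        (∫ x, c x * f' x * p x) ^ 2 / (∫ x, (d x / p x) ^ 2 * p x) ∧
      ((∫ x, f x ^ 2 * p x) - (∫ x, f x * p x) ^ 2 =
          (∫ x, c x * f' x * p x) ^ 2 / (∫ x, (d x / p x) ^ 2 * p x) ↔
        ∃ α β : ℝ,
          ∀ᵐ x ∂(volume.restrict {x : ℝ | a < (x : EReal) ∧ (x : EReal) < b}),
            f x = α * (d x / p x) + β) := by
  set S : Set ℝ := {x : ℝ | a < (x : EReal) ∧ (x : EReal) < b}
  have hSm : MeasurableSet S := measurableSet_setOf_coe_mem_Ioo a b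
  have hpS : ∀ x ∉ S, p x = 0 := fun x hx =>
    le_antisymm (not_lt.1 fun h => hx ((hppos x).1 h)) (hp0 x)
  have hposS : ∀ x ∈ S, 0 < p x := fun x hx => (hppos x).2 hx
  have hint : ∀ k : ℝ → ℝ, ∫ x in S, k x * p x = ∫ x, k x * p x := fun k =>
    setIntegral_eq_integral_of_forall_compl_eq_zero fun x hx => by rw [hpS x hx, mul_zero]
  have hp : Integrable p := Integrable.of_integral_ne_zero (by rw [hp1]; exact one_ne_zero)
  have hone : Integrable (fun x => (1 : ℝ) ^ 2 * p x) := by simpa using hp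
  have hsm : Measurable (fun x => d x / p x) := hdmeas.div hpmeas
  have hsp : Integrable (fun x => d x / p x * p x) := by
    simpa using integrable_mul_mul_of_sq hpmeas hp0 hsm measurable_const hd2 hone
  have hfp : Integrable (fun x => f x * p x) := by
    simpa using integrable_mul_mul_of_sq hpmeas hp0 hfmeas measurable_const hf2 hone
  have hfs : Integrable (fun x => f x * (d x / p x) * p x) :=
    integrable_mul_mul_of_sq hpmeas hp0 hfmeas hsm hf2 hd2
  have hsd : ∀ x ∈ S, d x / p x * p x = d x := fun x hx => div_mul_cancel₀ _ (hposS x hx).ne'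
  have hsp0 : ∫ x, d x / p x * p x = 0 := by
    rw [← hint, setIntegral_congr_fun hSm hsd]
    exact hcd.setIntegral_eq_zero hab (hsp.integrableOn.congr_fun hsd hSm) hlima hlimb
  have hfsd : ∀ x ∈ S, f x * (d x / p x) * p x = d x * f x := fun x hx => by
    rw [mul_assoc, hsd x hx, mul_comm]
  have hcp : ∀ x ∈ S, c x * f' x * p x = c x * p x * f' x := fun x _ => by ring
  have hstein : ∫ x, c x * f' x * p x = -∫ x, f x * (d x / p x) * p x := by
    have h1 := hfs.integrableOn.congr_fun hfsd hSm
    have h2 := hcf'.integrableOn.congr_fun hcp hSm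
    have h := hcd.setIntegral_mul_add_mul_eq_zero hab hACf hlima hlimb h1 h2
    rw [integral_add h1 h2, ← setIntegral_congr_fun hSm hfsd,
      ← setIntegral_congr_fun hSm hcp, hint, hint] at h
    linarith
  rw [hstein, neg_sq]
  have hres := integral_sq_residual_mul hp1 hp hsp hsp0 hd2 hfp hf2 hfs
  set I := ∫ x, (d x / p x) ^ 2 * p x
  set K := ∫ x, f x * (d x / p x) * p x
  set m := ∫ x, f x * p x
  obtain ⟨hRi, hR⟩ := hres (K / I) m
  have hR' : ∫ x, (f x - (K / I * (d x / p x) + m)) ^ 2 * p x =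
      (∫ x, f x ^ 2 * p x) - m ^ 2 - K ^ 2 / I := by
    rw [hR]
    field_simp
    ring
  have hR0 : ∀ x, 0 ≤ (f x - (K / I * (d x / p x) + m)) ^ 2 * p x := fun x =>
    mul_nonneg (sq_nonneg _) (hp0 x)
  have hgap : 0 ≤ (∫ x, f x ^ 2 * p x) - m ^ 2 - K ^ 2 / I :=
    hR' ▸ integral_nonneg_of_ae (Eventually.of_forall hR0)
  refine ⟨?_, fun heq => ⟨K / I, m, ?_⟩, ?_⟩
  · linarith
  · have hzero : ∫ x, (f x - (K / I * (d x / p x) + m)) ^ 2 * p x = 0 := by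
      rw [hR', heq, sub_self]
    rw [ae_restrict_iff' hSm]
    filter_upwards [(integral_eq_zero_iff_of_nonneg hR0 hRi).1 hzero] with x hx hxS
    have := (mul_eq_zero.1 hx).resolve_right (hposS x hxS).ne'
    exact sub_eq_zero.1 (pow_eq_zero_iff two_ne_zero |>.1 this)
  · rintro ⟨α, β, hαβ⟩
    obtain ⟨-, hαβR⟩ := hres α β
    have hzero : ∫ x, (f x - (α * (d x / p x) + β)) ^ 2 * p x = 0 := by
      rw [← hint]
      refine integral_eq_zero_of_ae ?_
      filter_upwards [hαβ] with x hx
      simp [hx]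
    have hmin : (∫ x, f x ^ 2 * p x) - m ^ 2 - K ^ 2 / I + (m - β) ^ 2
        + (α * I - K) ^ 2 / I = 0 := by
      rw [← hzero, hαβR]
      field_simp
      ring
    have : 0 ≤ (α * I - K) ^ 2 / I := by positivity
    linarith [sq_nonneg (m - β)]
end

section
/- (Klaassen upper variance bound, continuous case.) Let p be a probability density on ℝ positive exactly on the open interval S = (a, b), and let X have density p. Let h : ℝ → ℝ be locally absolutely continuous, strictly decreasing on S (so h'(x) < 0 for a.e. x ∈ S), with E|h(X)| < ∞. Then for every locally absolutely continuous f with E[f(X)²] < ∞ and such that the right-hand side below is finite: Var[f(X)] ≤ E[ f'(X)² · (−L_p h(X)) / h'(X) ], with equality if and only if there exist real numbers α, β with f = α h + β a.e. on S. -/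
open MeasureTheory Set

/-- The inverse Stein operator
`L_p h (x) = (1/p(x)) ∫_a^x (h(u) − E[h(X)]) p(u) du`. -/
noncomputable def invStein (p h : ℝ → ℝ) (x : ℝ) : ℝ :=
  (∫ u in Iio x, (h u - ∫ y, h y * p y) * p u) / p x

theorem LocAC.continuousOn {S : Set ℝ} {f f' : ℝ → ℝ} (hS : IsOpen S) (hf : LocAC S f f') :
    ContinuousOn f S := by
  intro x hx
  obtain ⟨ε, hε, hball⟩ := Metric.nhds_basis_closedBall.mem_iff.1 (hS.mem_nhds hx)
  rw [Real.closedBall_eq_Icc] at hball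
  have hl : x - ε ∈ S := hball ⟨le_rfl, by linarith⟩
  have hr : x + ε ∈ S := hball ⟨by linarith, le_rfl⟩
  have hmem : x ∈ uIcc (x - ε) (x + ε) := by
    rw [uIcc_of_le (by linarith)]; constructor <;> linarith
  have hcont := intervalIntegral.continuousOn_primitive_interval' (hf _ hl _ hr).1 hmem
  rw [uIcc_of_le (by linarith)] at hcont
  have hnhds : Icc (x - ε) (x + ε) ∈ nhds x := Icc_mem_nhds (by linarith) (by linarith)
  have hat : ContinuousAt (fun y => f x + ∫ t in x..y, f' t) x :=
    continuousAt_const.add (hcont.continuousAt hnhds)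
  refine (hat.congr ?_).continuousWithinAt
  filter_upwards [hnhds] with y hy
  linarith [(hf x hx y (hball hy)).2]

/-- Completing the square in the weighted energy `∫ f'² / (-h')`. -/
theorem integral_sq_sub_div_neg {x y : ℝ} (hxy : x ≤ y) {f' h' : ℝ → ℝ}
    (hf' : IntervalIntegrable f' volume x y) (hh' : IntervalIntegrable h' volume x y)
    (hneg : ∀ᵐ t ∂volume.restrict (Ioc x y), h' t < 0)
    (hE : IntegrableOn (fun t => f' t ^ 2 / -h' t) (Ioc x y)) (c : ℝ) :
    IntegrableOn (fun t => (f' t - c * h' t) ^ 2 / -h' t) (Ioc x y) ∧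
    ∫ t in Ioc x y, (f' t - c * h' t) ^ 2 / -h' t =
      (∫ t in Ioc x y, f' t ^ 2 / -h' t) + 2 * c * (∫ t in x..y, f' t)
        - c ^ 2 * ∫ t in x..y, h' t := by
  rw [intervalIntegral.integral_of_le hxy, intervalIntegral.integral_of_le hxy]
  have hfi := (intervalIntegrable_iff_integrableOn_Ioc_of_le hxy).1 hf'
  have hhi := (intervalIntegrable_iff_integrableOn_Ioc_of_le hxy).1 hh'
  have hae : (fun t => (f' t - c * h' t) ^ 2 / -h' t) =ᵐ[volume.restrict (Ioc x y)]
      fun t => (f' t ^ 2 / -h' t + 2 * c * f' t) - c ^ 2 * h' t := by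
    filter_upwards [hneg] with t ht
    have := ht.ne
    field_simp
    ring
  have hsum : IntegrableOn (fun t => f' t ^ 2 / -h' t + 2 * c * f' t) (Ioc x y) :=
    hE.add (hfi.const_mul _)
  refine ⟨(hsum.sub (hhi.const_mul _)).congr hae.symm, ?_⟩
  rw [integral_congr_ae hae, integral_sub hsum (hhi.const_mul _),
    integral_add hE (hfi.const_mul _), integral_const_mul, integral_const_mul]

/-- Cauchy–Schwarz for increments, together with its equality case. -/
theorem LocAC.sq_sub_le {S : Set ℝ} {f f' h h' : ℝ → ℝ} (hS : S.OrdConnected)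
    (hf : LocAC S f f') (hh : LocAC S h h')
    (hneg : ∀ᵐ t ∂volume.restrict S, h' t < 0) {x y : ℝ} (hx : x ∈ S) (hy : y ∈ S)
    (hxy : x < y) (hlt : h y < h x) (hE : IntegrableOn (fun t => f' t ^ 2 / -h' t) (Ioc x y)) :
    (f y - f x) ^ 2 ≤ (∫ t in Ioc x y, f' t ^ 2 / -h' t) * (h x - h y) ∧
    ((f y - f x) ^ 2 = (∫ t in Ioc x y, f' t ^ 2 / -h' t) * (h x - h y) →
      ∀ z ∈ Icc x y, (f z - f x) * (h y - h x) = (f y - f x) * (h z - h x)) := by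
  have hsub : Ioc x y ⊆ S := Ioc_subset_Icc_self.trans (hS.out hx hy)
  have hneg' := ae_restrict_of_ae_restrict_of_subset hsub hneg
  set c : ℝ := (f y - f x) / (h y - h x) with hc
  obtain ⟨hint, heq⟩ := integral_sq_sub_div_neg hxy.le (hf x hx y hy).1 (hh x hx y hy).1 hneg' hE c
  rw [← (hf x hx y hy).2, ← (hh x hx y hy).2] at heq
  have hne : h y - h x ≠ 0 := by linarith
  have hcf : f y - f x = c * (h y - h x) := by rw [hc]; field_simp
  have hpos : 0 ≤ᵐ[volume.restrict (Ioc x y)] fun t => (f' t - c * h' t) ^ 2 / -h' t := by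
    filter_upwards [hneg'] with t ht
    exact div_nonneg (sq_nonneg _) (by linarith)
  have hnn := integral_nonneg_of_ae hpos
  have hkey : (∫ t in Ioc x y, f' t ^ 2 / -h' t) * (h x - h y) - (f y - f x) ^ 2 =
      (∫ t in Ioc x y, (f' t - c * h' t) ^ 2 / -h' t) * (h x - h y) := by
    rw [heq, hcf]; ring
  refine ⟨by nlinarith, fun hequal z hz => ?_⟩
  have hzero : ∫ t in Ioc x y, (f' t - c * h' t) ^ 2 / -h' t = 0 := by
    have : (∫ t in Ioc x y, (f' t - c * h' t) ^ 2 / -h' t) * (h x - h y) = 0 := by linarith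
    exact (mul_eq_zero.1 this).resolve_right (by linarith)
  have hae : ∀ᵐ t ∂volume.restrict (Ioc x y), f' t = c * h' t := by
    filter_upwards [(integral_eq_zero_iff_of_nonneg_ae hpos hint).1 hzero, hneg'] with t ht hnt
    have h2 : (f' t - c * h' t) ^ 2 = 0 :=
      (div_eq_zero_iff.1 ht).resolve_right (by linarith)
    linarith [pow_eq_zero_iff (two_ne_zero) |>.1 h2]
  have hzS := hS.out hx hy hz
  have hfz : f z - f x = c * (h z - h x) := by
    rw [(hf x hx z hzS).2, (hh x hx z hzS).2, intervalIntegral.integral_of_le hz.1,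
      intervalIntegral.integral_of_le hz.1, ← integral_const_mul]
    exact integral_congr_ae
      (ae_restrict_of_ae_restrict_of_subset (Ioc_subset_Ioc_right hz.2) hae)
  rw [hfz, hcf]; ring

theorem LocAC.deriv_ae_eq {S : Set ℝ} {f f' h h' : ℝ → ℝ} (hS : S.OrdConnected)
    (hf : LocAC S f f') (hh : LocAC S h h') {α β : ℝ} (hfh : ∀ x ∈ S, f x = α * h x + β)
    {x y : ℝ} (hx : x ∈ S) (hy : y ∈ S) (hxy : x ≤ y) :
    ∀ᵐ t ∂volume.restrict (Ioc x y), f' t = α * h' t := by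
  have hint : IntervalIntegrable (fun t => f' t - α * h' t) volume x y :=
    (hf x hx y hy).1.sub ((hh x hx y hy).1.const_mul α)
  have hd := hint.ae_hasDerivAt_integral
  rw [uIcc_of_le hxy] at hd
  rw [ae_restrict_congr_set Ioo_ae_eq_Ioc.symm, ae_restrict_iff' measurableSet_Ioo]
  filter_upwards [hd] with t ht htm
  have hdt := ht (Ioo_subset_Icc_self htm) x (left_mem_Icc.2 hxy)
  have hzero : (fun s => ∫ u in x..s, f' u - α * h' u) =ᶠ[nhds t] fun _ => 0 := by
    filter_upwards [Icc_mem_nhds htm.1 htm.2] with s hs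
    have hsS := hS.out hx hy hs
    rw [intervalIntegral.integral_sub (hf x hx s hsS).1 ((hh x hx s hsS).1.const_mul α),
      intervalIntegral.integral_const_mul, ← (hf x hx s hsS).2, ← (hh x hx s hsS).2,
      hfh s hsS, hfh x hx]
    ring
  have := hdt.unique ((hasDerivAt_const t (0 : ℝ)).congr_of_eventuallyEq hzero)
  linarith

theorem integral_sq_sub_sq_integral_eq_prod {μ : Measure ℝ} [IsProbabilityMeasure μ] {f : ℝ → ℝ}
    (hf : MemLp f 2 μ) :
    Integrable (fun q : ℝ × ℝ => {q : ℝ × ℝ | q.1 < q.2}.indicator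
      (fun q => (f q.2 - f q.1) ^ 2) q) (μ.prod μ) ∧
    (∫ x, f x ^ 2 ∂μ) - (∫ x, f x ∂μ) ^ 2 =
      ∫ q : ℝ × ℝ, {q : ℝ × ℝ | q.1 < q.2}.indicator
        (fun q => (f q.2 - f q.1) ^ 2) q ∂(μ.prod μ) := by
  have hf1 : Integrable f μ := hf.integrable (by norm_num)
  have hf2 : Integrable (fun x => f x ^ 2) μ := hf.integrable_sq
  have hprod : Integrable (fun q : ℝ × ℝ => f q.1 * f q.2) (μ.prod μ) := hf1.mul_prod hf1
  have hadd : Integrable (fun q : ℝ × ℝ => f q.2 ^ 2 + f q.1 ^ 2) (μ.prod μ) :=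
    (hf2.comp_snd μ).add (hf2.comp_fst μ)
  have hexp : (fun q : ℝ × ℝ => (f q.2 - f q.1) ^ 2) =
      fun q => (f q.2 ^ 2 + f q.1 ^ 2) - 2 * (f q.1 * f q.2) := by
    ext q; ring
  have hsq : Integrable (fun q : ℝ × ℝ => (f q.2 - f q.1) ^ 2) (μ.prod μ) := by
    rw [hexp]; exact hadd.sub (hprod.const_mul 2)
  have hmeas : MeasurableSet {q : ℝ × ℝ | q.1 < q.2} := measurableSet_lt measurable_fst measurable_snd
  set g : ℝ × ℝ → ℝ := {q : ℝ × ℝ | q.1 < q.2}.indicator (fun q => (f q.2 - f q.1) ^ 2) with hg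
  have hgi : Integrable g (μ.prod μ) := hsq.indicator hmeas
  refine ⟨hgi, ?_⟩
  have htotal : ∫ q : ℝ × ℝ, (f q.2 - f q.1) ^ 2 ∂(μ.prod μ) =
      2 * ((∫ x, f x ^ 2 ∂μ) - (∫ x, f x ∂μ) ^ 2) := by
    rw [hexp, integral_sub hadd (hprod.const_mul 2),
      integral_add (hf2.comp_snd μ) (hf2.comp_fst μ), integral_const_mul,
      integral_prod_mul f f, integral_fun_snd (fun x => f x ^ 2),
      integral_fun_fst (fun x => f x ^ 2)]
    simp only [probReal_univ, smul_eq_mul, one_mul]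
    ring
  have hsplit : (fun q : ℝ × ℝ => (f q.2 - f q.1) ^ 2) = fun q => g q + g q.swap := by
    ext ⟨x, y⟩
    simp only [hg, indicator, mem_ofPred_eq, Prod.swap]
    rcases lt_trichotomy x y with hxy | rfl | hxy
    · simp [hxy, hxy.le]
    · simp
    · simp only [hxy, hxy.not_gt, if_true, if_false]; ring
  have hhalf : ∫ q : ℝ × ℝ, (f q.2 - f q.1) ^ 2 ∂(μ.prod μ) = 2 * ∫ q, g q ∂(μ.prod μ) := by
    rw [hsplit]
    refine (integral_add hgi hgi.swap).trans ?_
    simp only [Function.comp_apply]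
    rw [integral_prod_swap g]
    ring
  change _ = ∫ q, g q ∂(μ.prod μ)
  linarith

theorem lintegral_Iio_prod_Ici_ofReal_sub {μ : Measure ℝ} [IsProbabilityMeasure μ] {S : Set ℝ}
    (hS : ∀ᵐ x ∂μ, x ∈ S) {h : ℝ → ℝ} (hanti : AntitoneOn h S) (hint : Integrable h μ) (t : ℝ) :
    ∫⁻ q in Iio t ×ˢ Ici t, ENNReal.ofReal (h q.1 - h q.2) ∂(μ.prod μ) =
      ENNReal.ofReal (∫ u in Iio t, (h u - ∫ y, h y ∂μ) ∂μ) ∧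
    0 ≤ ∫ u in Iio t, (h u - ∫ y, h y ∂μ) ∂μ := by
  have hi1 : Integrable h (μ.restrict (Iio t)) := hint.restrict
  have hi2 : Integrable h (μ.restrict (Ici t)) := hint.restrict
  have hS1 : ∀ᵐ q ∂(μ.prod μ), q.1 ∈ S := Measure.quasiMeasurePreserving_fst.ae hS
  have hS2 : ∀ᵐ q ∂(μ.prod μ), q.2 ∈ S := Measure.quasiMeasurePreserving_snd.ae hS
  have hnn : 0 ≤ᵐ[(μ.prod μ).restrict (Iio t ×ˢ Ici t)] fun q => h q.1 - h q.2 := by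
    filter_upwards [ae_restrict_of_ae hS1, ae_restrict_of_ae hS2,
      ae_restrict_mem (measurableSet_Iio.prod measurableSet_Ici)] with q h1 h2 hq
    exact sub_nonneg.2 (hanti h1 h2 (hq.1.le.trans hq.2))
  rw [← Measure.prod_restrict] at hnn ⊢
  have hc1 := hi1.comp_fst (μ.restrict (Ici t))
  have hc2 := hi2.comp_snd (μ.restrict (Iio t))
  have hsum : (∫ u in Iio t, h u ∂μ) + ∫ u in Ici t, h u ∂μ = ∫ y, h y ∂μ := by
    rw [← integral_add_compl measurableSet_Iio hint, compl_Iio]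
  have hmass : μ.real (Iio t) + μ.real (Ici t) = 1 := by
    rw [← compl_Iio]; exact probReal_add_probReal_compl measurableSet_Iio
  have heq : ∫ u in Iio t, (h u - ∫ y, h y ∂μ) ∂μ =
      ∫ q : ℝ × ℝ, (h q.1 - h q.2) ∂((μ.restrict (Iio t)).prod (μ.restrict (Ici t))) := by
    rw [integral_sub hc1 hc2, integral_fun_fst, integral_fun_snd,
      integral_sub hi1 (integrable_const _)]
    simp only [measureReal_restrict_apply_univ, smul_eq_mul, integral_const, ← hsum]
    rw [eq_sub_of_add_eq' hmass]
    ring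
  rw [heq]
  exact ⟨(ofReal_integral_eq_lintegral_ofReal (hc1.sub hc2) hnn).symm, integral_nonneg_of_ae hnn⟩

theorem lintegral_setLIntegral_Ioc_mul {μ : Measure ℝ} [SFinite μ] {k : ℝ → ENNReal}
    (hk : Measurable k) {w : ℝ × ℝ → ENNReal} (hw : Measurable w) :
    Measurable (fun q : ℝ × ℝ => (∫⁻ t in Ioc q.1 q.2, k t) * w q) ∧
    ∫⁻ q, (∫⁻ t in Ioc q.1 q.2, k t) * w q ∂(μ.prod μ) =
      ∫⁻ t, k t * ∫⁻ q in Iio t ×ˢ Ici t, w q ∂(μ.prod μ) := by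
  let s : Set ((ℝ × ℝ) × ℝ) := {r | r.1.1 < r.2} ∩ {r | r.2 ≤ r.1.2}
  have hs : MeasurableSet s :=
    (measurableSet_lt (by fun_prop) (by fun_prop)).inter
      (measurableSet_le (by fun_prop) (by fun_prop))
  have hF : Measurable (s.indicator fun r => k r.2 * w r.1) :=
    Measurable.indicator (by fun_prop) hs
  have hleft (q : ℝ × ℝ) : (∫⁻ t in Ioc q.1 q.2, k t) * w q =
      ∫⁻ t, s.indicator (fun r => k r.2 * w r.1) (q, t) := by
    rw [← lintegral_mul_const _ hk, ← lintegral_indicator measurableSet_Ioc]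
    rfl
  have hright (t : ℝ) : k t * ∫⁻ q in Iio t ×ˢ Ici t, w q ∂(μ.prod μ) =
      ∫⁻ q, s.indicator (fun r => k r.2 * w r.1) (q, t) ∂(μ.prod μ) := by
    rw [← lintegral_const_mul _ hw,
      ← lintegral_indicator (measurableSet_Iio.prod measurableSet_Ici)]
    rfl
  simp_rw [hleft, hright]
  exact ⟨hF.lintegral_prod_right', lintegral_lintegral_swap hF.aemeasurable⟩

/-- If increments of `f` and `h` are proportional on almost every interval, then `f` is an affine
function of `h`. -/
theorem exists_affine_of_ae_collinear {S : Set ℝ} (hSo : IsOpen S) {f h : ℝ → ℝ}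
    (hf : ContinuousOn f S) (hh : ContinuousOn h S) (hanti : StrictAntiOn h S)
    (hae : ∀ᵐ q : ℝ × ℝ, q.1 ∈ S → q.2 ∈ S → q.1 < q.2 → ∀ z ∈ Icc q.1 q.2,
      (f z - f q.1) * (h q.2 - h q.1) = (f q.2 - f q.1) * (h z - h q.1)) :
    ∃ α β : ℝ, ∀ x ∈ S, f x = α * h x + β := by
  have hall : ∀ x ∈ S, ∀ y ∈ S, ∀ z, x < z → z < y →
      (f z - f x) * (h y - h x) = (f y - f x) * (h z - h x) := by
    intro x hx y hy z hxz hzy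
    by_contra hne
    have hf1 : ContinuousAt (fun q : ℝ × ℝ => f q.1) (x, y) :=
      (hf.continuousAt (hSo.mem_nhds hx)).comp_of_eq continuousAt_fst rfl
    have hf2 : ContinuousAt (fun q : ℝ × ℝ => f q.2) (x, y) :=
      (hf.continuousAt (hSo.mem_nhds hy)).comp_of_eq continuousAt_snd rfl
    have hh1 : ContinuousAt (fun q : ℝ × ℝ => h q.1) (x, y) :=
      (hh.continuousAt (hSo.mem_nhds hx)).comp_of_eq continuousAt_fst rfl
    have hh2 : ContinuousAt (fun q : ℝ × ℝ => h q.2) (x, y) :=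
      (hh.continuousAt (hSo.mem_nhds hy)).comp_of_eq continuousAt_snd rfl
    have hne' : ∀ᶠ q : ℝ × ℝ in nhds (x, y),
        (f z - f q.1) * (h q.2 - h q.1) ≠ (f q.2 - f q.1) * (h z - h q.1) :=
      (ContinuousAt.ne_iff_eventually_ne ((continuousAt_const.sub hf1).mul (hh2.sub hh1))
        ((hf2.sub hf1).mul (continuousAt_const.sub hh1))).1 hne
    have hbox : (S ∩ Iio z) ×ˢ (S ∩ Ioi z) ∈ nhds (x, y) :=
      prod_mem_nhds (Filter.inter_mem (hSo.mem_nhds hx) (Iio_mem_nhds hxz))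
        (Filter.inter_mem (hSo.mem_nhds hy) (Ioi_mem_nhds hzy))
    obtain ⟨q, hqae, hq, hqbox⟩ :=
      (Measure.dense_of_ae hae).inter_nhds_nonempty (Filter.inter_mem hne' hbox)
    obtain ⟨⟨h1, h1z⟩, h2, h2z⟩ := hqbox
    exact hq (hqae h1 h2 (h1z.trans h2z) z ⟨h1z.le, h2z.le⟩)
  rcases S.eq_empty_or_nonempty with rfl | ⟨x, hx⟩
  · exact ⟨0, 0, by simp⟩
  obtain ⟨ε, hε, hball⟩ := Metric.nhds_basis_closedBall.mem_iff.1 (hSo.mem_nhds hx)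
  have hy : x + ε ∈ S := hball (by rw [Real.closedBall_eq_Icc]; constructor <;> linarith)
  have hxy : x < x + ε := by linarith
  generalize x + ε = y at hy hxy
  have hlt := hanti hx hy hxy
  have hne : h y - h x ≠ 0 := by linarith
  refine ⟨(f y - f x) / (h y - h x), f x - (f y - f x) / (h y - h x) * h x, fun z hz => ?_⟩
  have hcol : (f z - f x) * (h y - h x) = (f y - f x) * (h z - h x) := by
    rcases lt_trichotomy z x with hzx | rfl | hxz
    · linarith [hall z hz y hy x hzx hxy]
    · ring
    rcases lt_trichotomy z y with hzy | rfl | hyz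
    · exact hall x hx y hy z hxz hzy
    · ring
    · linarith [hall x hx z hz y hxy hyz]
  field_simp
  linarith

/-- The variance bound for a probability measure `μ` carried by `S`, with the Stein kernel written
as the integrated tail of `h - E h`. -/
theorem variance_le_integral_of_strictAntiOn {μ : Measure ℝ} [IsProbabilityMeasure μ] {S : Set ℝ}
    (hSo : IsOpen S) (hSc : S.OrdConnected) (hS : ∀ᵐ x ∂μ, x ∈ S)
    (hac : volume.restrict S ≪ μ) {f f' h h' : ℝ → ℝ} (hhmeas : Measurable h)
    (hh'meas : Measurable h') (hf'meas : Measurable f') (hACh : LocAC S h h')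
    (hanti : StrictAntiOn h S) (hneg : ∀ᵐ x ∂volume.restrict S, h' x < 0) (hhint : Integrable h μ)
    (hACf : LocAC S f f') (hf2 : MemLp f 2 μ)
    (hrhs : Integrable (fun t => S.indicator (fun t => f' t ^ 2 / -h' t) t *
      ∫ u in Iio t, (h u - ∫ y, h y ∂μ) ∂μ)) :
    (∫ x, f x ^ 2 ∂μ) - (∫ x, f x ∂μ) ^ 2 ≤
        ∫ t, S.indicator (fun t => f' t ^ 2 / -h' t) t *
          ∫ u in Iio t, (h u - ∫ y, h y ∂μ) ∂μ ∧
      ((∫ x, f x ^ 2 ∂μ) - (∫ x, f x ∂μ) ^ 2 =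
          ∫ t, S.indicator (fun t => f' t ^ 2 / -h' t) t *
            ∫ u in Iio t, (h u - ∫ y, h y ∂μ) ∂μ ↔
        ∃ α β : ℝ, ∀ᵐ x ∂volume.restrict S, f x = α * h x + β) := by
  set H : ℝ → ℝ := fun t => ∫ u in Iio t, (h u - ∫ y, h y ∂μ) ∂μ with hH
  set e : ℝ → ℝ := fun t => f' t ^ 2 / -h' t with he
  change Integrable (fun t => S.indicator e t * H t) at hrhs
  change _ ≤ ∫ t, S.indicator e t * H t ∧ (_ = ∫ t, S.indicator e t * H t ↔ _)
  have hemeas : Measurable e := by fun_prop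
  have henn : ∀ᵐ t ∂volume.restrict S, 0 ≤ e t := by
    filter_upwards [hneg] with t ht
    exact div_nonneg (sq_nonneg _) (by linarith)
  have hinn : ∀ᵐ t, 0 ≤ S.indicator e t := by
    filter_upwards [(ae_restrict_iff' hSo.measurableSet).1 henn] with t ht
    exact indicator_apply_nonneg ht
  have hker := lintegral_Iio_prod_Ici_ofReal_sub hS hanti.antitoneOn hhint
  set k : ℝ → ENNReal := fun t => ENNReal.ofReal (S.indicator e t) with hk
  have hkmeas : Measurable k := (hemeas.indicator hSo.measurableSet).ennreal_ofReal
  have hwmeas : Measurable fun q : ℝ × ℝ => ENNReal.ofReal (h q.1 - h q.2) := by fun_prop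
  obtain ⟨hGmeas, hGlint⟩ := lintegral_setLIntegral_Ioc_mul (μ := μ) hkmeas hwmeas
  set G : ℝ × ℝ → ENNReal :=
    fun q => (∫⁻ t in Ioc q.1 q.2, k t) * ENNReal.ofReal (h q.1 - h q.2) with hG
  have hGeq : ∫⁻ q, G q ∂(μ.prod μ) = ENNReal.ofReal (∫ t, S.indicator e t * H t) := by
    rw [hGlint, ofReal_integral_eq_lintegral_ofReal hrhs
      (hinn.mono fun t ht => mul_nonneg ht (hker t).2)]
    refine lintegral_congr_ae (hinn.mono fun t ht => ?_)
    simp only [(hker t).1, hk, ENNReal.ofReal_mul ht, hH]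
  have hGtop : ∫⁻ q, G q ∂(μ.prod μ) ≠ ⊤ := by rw [hGeq]; exact ENNReal.ofReal_ne_top
  have hGfin := ae_lt_top hGmeas hGtop
  have hGint : Integrable (fun q => (G q).toReal) (μ.prod μ) :=
    integrable_toReal_of_lintegral_ne_top hGmeas.aemeasurable hGtop
  have hGval : ∫ q, (G q).toReal ∂(μ.prod μ) = ∫ t, S.indicator e t * H t := by
    rw [integral_toReal hGmeas.aemeasurable hGfin, hGeq, ENNReal.toReal_ofReal]
    exact integral_nonneg_of_ae (hinn.mono fun t ht => mul_nonneg ht (hker t).2)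
  have hlint : ∀ x ∈ S, ∀ y ∈ S,
      ∫⁻ t in Ioc x y, k t = ∫⁻ t in Ioc x y, ENNReal.ofReal (e t) := fun x hx y hy =>
    setLIntegral_congr_fun measurableSet_Ioc fun t ht => by
      simp only [hk, indicator_of_mem (hSc.out hx hy (Ioc_subset_Icc_self ht))]
  have hnnIoc : ∀ x ∈ S, ∀ y ∈ S, 0 ≤ᵐ[volume.restrict (Ioc x y)] e := fun x hx y hy =>
    ae_restrict_of_ae_restrict_of_subset (Ioc_subset_Icc_self.trans (hSc.out hx hy)) henn
  have hGreal : ∀ q : ℝ × ℝ, q.1 ∈ S → q.2 ∈ S → q.1 < q.2 →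
      (G q).toReal = (∫ t in Ioc q.1 q.2, e t) * (h q.1 - h q.2) := by
    intro q h1 h2 hq
    rw [hG, ENNReal.toReal_mul, ENNReal.toReal_ofReal (sub_nonneg.2 (hanti h1 h2 hq).le),
      hlint _ h1 _ h2, integral_eq_lintegral_of_nonneg_ae (hnnIoc _ h1 _ h2)
        hemeas.aestronglyMeasurable]
  have hS1 : ∀ᵐ q ∂(μ.prod μ), q.1 ∈ S := Measure.quasiMeasurePreserving_fst.ae hS
  have hS2 : ∀ᵐ q ∂(μ.prod μ), q.2 ∈ S := Measure.quasiMeasurePreserving_snd.ae hS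
  obtain ⟨hKint, hvar⟩ := integral_sq_sub_sq_integral_eq_prod hf2
  set K : ℝ × ℝ → ℝ := {q : ℝ × ℝ | q.1 < q.2}.indicator fun q => (f q.2 - f q.1) ^ 2 with hK
  have hKlt : ∀ q : ℝ × ℝ, q.1 < q.2 → K q = (f q.2 - f q.1) ^ 2 := fun q hq =>
    indicator_of_mem (s := {q : ℝ × ℝ | q.1 < q.2}) hq _
  have hKge : ∀ q : ℝ × ℝ, ¬ q.1 < q.2 → K q = 0 := fun q hq =>
    indicator_of_notMem (s := {q : ℝ × ℝ | q.1 < q.2}) hq _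
  have hCS : ∀ᵐ q ∂(μ.prod μ), q.1 < q.2 → (f q.2 - f q.1) ^ 2 ≤ (G q).toReal ∧
      ((f q.2 - f q.1) ^ 2 = (G q).toReal → ∀ z ∈ Icc q.1 q.2,
        (f z - f q.1) * (h q.2 - h q.1) = (f q.2 - f q.1) * (h z - h q.1)) := by
    filter_upwards [hS1, hS2, hGfin] with q h1 h2 hfin hq
    have hlt := hanti h1 h2 hq
    rw [hGreal q h1 h2 hq]
    refine hACf.sq_sub_le hSc hACh hneg h1 h2 hq hlt ⟨hemeas.aestronglyMeasurable, ?_⟩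
    rw [hasFiniteIntegral_iff_ofReal (hnnIoc _ h1 _ h2), ← hlint _ h1 _ h2]
    refine ENNReal.lt_top_of_mul_ne_top_left hfin.ne ?_
    simpa using hlt
  have hKG : K ≤ᵐ[μ.prod μ] fun q => (G q).toReal := by
    filter_upwards [hCS] with q hq
    by_cases hlt : q.1 < q.2
    · rw [hKlt q hlt]; exact (hq hlt).1
    · rw [hKge q hlt]; exact ENNReal.toReal_nonneg
  rw [hvar, ← hGval]
  refine ⟨integral_mono_ae hKint hGint hKG, ?_⟩
  rw [integral_eq_iff_of_ae_le hKint hGint hKG]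
  have hfc := hACf.continuousOn hSo
  have hhc := hACh.continuousOn hSo
  constructor
  · intro hEq
    have hcol : ∀ᵐ q ∂(μ.prod μ), q.1 < q.2 → ∀ z ∈ Icc q.1 q.2,
        (f z - f q.1) * (h q.2 - h q.1) = (f q.2 - f q.1) * (h z - h q.1) := by
      filter_upwards [hCS, hEq] with q hq hqe hlt
      exact (hq hlt).2 (by rw [← hKlt q hlt, hqe])
    have hcolS := (hac.prod hac).ae_le hcol
    rw [Measure.prod_restrict, ← Measure.volume_eq_prod] at hcolS
    have hcol_vol := (ae_restrict_iff' (hSo.measurableSet.prod hSo.measurableSet)).1 hcolS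
    obtain ⟨α, β, hαβ⟩ := exists_affine_of_ae_collinear hSo hfc hhc hanti
      (hcol_vol.mono fun q hq h1 h2 => hq ⟨h1, h2⟩)
    exact ⟨α, β, ae_restrict_of_forall_mem hSo.measurableSet hαβ⟩
  · rintro ⟨α, β, hαβ⟩
    have hall : ∀ x ∈ S, f x = α * h x + β := Measure.eqOn_open_of_ae_eq hαβ hSo hfc
      ((continuousOn_const.mul hhc).add continuousOn_const)
    filter_upwards [hS1, hS2] with q h1 h2
    by_cases hlt : q.1 < q.2
    · rw [hKlt q hlt, hGreal q h1 h2 hlt]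
      have hsub : Ioc q.1 q.2 ⊆ S := Ioc_subset_Icc_self.trans (hSc.out h1 h2)
      have hint : ∫ t in Ioc q.1 q.2, e t = ∫ t in Ioc q.1 q.2, -α ^ 2 * h' t := by
        refine integral_congr_ae ?_
        filter_upwards [hACf.deriv_ae_eq hSc hACh hall h1 h2 hlt.le,
          ae_restrict_of_ae_restrict_of_subset hsub hneg] with t ht hnt
        have := hnt.ne
        rw [he]
        simp only [ht]
        field_simp
      rw [hint, integral_const_mul, ← intervalIntegral.integral_of_le hlt.le,
        ← (hACh _ h1 _ h2).2, hall _ h1, hall _ h2]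
      ring
    · rw [hKge q hlt, hG]
      simp [Ioc_eq_empty hlt]

/-- Klaassen's upper variance bound, continuous case: for a probability density `p`
positive exactly on the open interval `S`, and `h` locally absolutely continuous and
strictly decreasing on `S` (`h' < 0` a.e. on `S`) with `E|h(X)| < ∞`,
`Var[f(X)] ≤ E[f'(X)² (−L_p h(X)) / h'(X)]`, with equality iff `f = α h + β`
a.e. on `S` for some reals `α, β`. -/
theorem klaassen_upper_bound_continuous
    (p : ℝ → ℝ) (S : Set ℝ) (hSopen : IsOpen S) (hSconn : S.OrdConnected)
    (hpmeas : Measurable p) (hp0 : ∀ x, 0 ≤ p x)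
    (hppos : ∀ x : ℝ, 0 < p x ↔ x ∈ S)
    (hp1 : ∫ x, p x = 1)
    (h h' : ℝ → ℝ) (hhmeas : Measurable h) (hh'meas : Measurable h')
    (hACh : LocAC S h h') (hanti : StrictAntiOn h S)
    (hh'neg : ∀ᵐ x ∂(volume.restrict S), h' x < 0)
    (hhint : Integrable (fun x => h x * p x))
    (f f' : ℝ → ℝ) (hfmeas : Measurable f) (hf'meas : Measurable f')
    (hACf : LocAC S f f')
    (hf2 : Integrable (fun x => f x ^ 2 * p x))
    (hrhs : Integrable (fun x => f' x ^ 2 * (-(invStein p h x)) / h' x * p x)) :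
    (∫ x, f x ^ 2 * p x) - (∫ x, f x * p x) ^ 2 ≤
        ∫ x, f' x ^ 2 * (-(invStein p h x)) / h' x * p x ∧
      ((∫ x, f x ^ 2 * p x) - (∫ x, f x * p x) ^ 2 =
          ∫ x, f' x ^ 2 * (-(invStein p h x)) / h' x * p x ↔
        ∃ α β : ℝ, ∀ᵐ x ∂(volume.restrict S), f x = α * h x + β) := by
  set μ : Measure ℝ := volume.withDensity fun x => ENNReal.ofReal (p x) with hμ
  have hdm : Measurable fun x => ENNReal.ofReal (p x) := hpmeas.ennreal_ofReal
  have hfin : ∀ᵐ x, ENNReal.ofReal (p x) < ⊤ := Filter.Eventually.of_forall fun _ =>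
    ENNReal.ofReal_lt_top
  have : IsProbabilityMeasure μ := ⟨by
    rw [hμ, withDensity_apply _ MeasurableSet.univ, Measure.restrict_univ,
      ← ofReal_integral_eq_lintegral_ofReal (integrable_of_integral_eq_one hp1)
        (Filter.Eventually.of_forall hp0), hp1, ENNReal.ofReal_one]⟩
  have hint (g : ℝ → ℝ) : ∫ x, g x ∂μ = ∫ x, g x * p x := by
    rw [hμ, integral_withDensity_eq_integral_toReal_smul hdm hfin]
    simp only [ENNReal.toReal_ofReal (hp0 _), smul_eq_mul, mul_comm]
  have hsetint (g : ℝ → ℝ) (t : ℝ) : ∫ x in Iio t, g x ∂μ = ∫ x in Iio t, g x * p x := by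
    rw [hμ, setIntegral_withDensity_eq_setIntegral_toReal_smul hdm
      (ae_restrict_of_ae hfin) _ measurableSet_Iio]
    simp only [ENNReal.toReal_ofReal (hp0 _), smul_eq_mul, mul_comm]
  have hintegrable (g : ℝ → ℝ) : Integrable g μ ↔ Integrable fun x => g x * p x := by
    rw [hμ, integrable_withDensity_iff hdm hfin]
    simp only [ENNReal.toReal_ofReal (hp0 _)]
  have hae (P : ℝ → Prop) : (∀ᵐ x ∂μ, P x) ↔ ∀ᵐ x ∂volume.restrict S, P x := by
    rw [hμ, ae_withDensity_iff hdm, ae_restrict_iff' hSopen.measurableSet]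
    simp only [ne_eq, ENNReal.ofReal_eq_zero, not_le, hppos]
  have hS : ∀ᵐ x ∂μ, x ∈ S := (hae _).2 (ae_restrict_mem hSopen.measurableSet)
  have hac : volume.restrict S ≪ μ := Measure.ae_le_iff_absolutelyContinuous.1
    fun s hs => (hae (· ∈ s)).1 hs
  have hf2' : MemLp f 2 μ :=
    (memLp_two_iff_integrable_sq hfmeas.aestronglyMeasurable).2 ((hintegrable _).2 hf2)
  have hstein : (fun x => f' x ^ 2 * (-(invStein p h x)) / h' x * p x) =
      fun t => S.indicator (fun t => f' t ^ 2 / -h' t) t *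
        ∫ u in Iio t, (h u - ∫ y, h y ∂μ) ∂μ := by
    ext t
    rw [hsetint, hint h, invStein]
    by_cases ht : t ∈ S
    · rw [indicator_of_mem ht]
      generalize ∫ u in Iio t, (h u - ∫ y, h y * p y) * p u = c
      have hc : c / p t * p t = c := div_mul_cancel₀ c ((hppos t).2 ht).ne'
      calc f' t ^ 2 * -(c / p t) / h' t * p t = -(f' t ^ 2 / h' t) * (c / p t * p t) := by ring
        _ = f' t ^ 2 / -h' t * c := by rw [hc, div_neg]
    · have hpt : p t = 0 := le_antisymm (not_lt.1 fun hpos => ht ((hppos t).1 hpos)) (hp0 t)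
      rw [indicator_of_notMem ht, hpt, mul_zero, zero_mul]
  rw [hstein] at hrhs ⊢
  rw [← hint f, ← hint fun x => f x ^ 2]
  exact variance_le_integral_of_strictAntiOn hSopen hSconn hS hac hhmeas hh'meas hf'meas hACh
    hanti hh'neg ((hintegrable h).2 hhint) hACf hf2' hrhs
end

section
/- (First-order variance expansion with exact remainder, continuous case.) Let p be a probability density on ℝ positive exactly on the open interval S, and let X, X₁, X₂, X₃, X₄ be i.i.d. with density p. Let h : ℝ → ℝ be locally absolutely continuous with h'(x) > 0 for a.e. x ∈ S and E|h(X)| < ∞, and let g : ℝ → ℝ be locally absolutely continuous with E[g(X)²] < ∞ and all expectations below finite. Set g₁ = g'/h', and Γ₁(x) = (1/p(x)) E[(h(X₂) − h(X₁)) · 1{X₁ ≤ x ≤ X₂}] for x ∈ S. Then Var[g(X)] = E[ (g'(X))²/h'(X) · Γ₁(X) ] − R₁, where R₁ = E[ h'(X₃) h'(X₄) (g₁(X₄) − g₁(X₃))² · 1{X₁ ≤ X₃ ≤ X₄ ≤ X₂}/(p(X₃) p(X₄)) ] ≥ 0; in particular Var[g(X)] ≤ E[(g'(X))² Γ₁(X)/h'(X)].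 -/
open MeasureTheory Set

/-- The probability measure on `ℝ` with Lebesgue density `p`. -/
noncomputable def dens (p : ℝ → ℝ) : Measure ℝ :=
  MeasureTheory.volume.withDensity fun x => ENNReal.ofReal (p x)

/-- The first-order Stein coefficient
`Γ₁(x) = (1/p(x)) E[(h(X₂) − h(X₁)) 1{X₁ ≤ x ≤ X₂}]` (for `X₁, X₂` i.i.d. ~ `p`). -/
noncomputable def Gamma1 (p h : ℝ → ℝ) (x : ℝ) : ℝ :=
  (∫ q : ℝ × ℝ, (if q.1 ≤ x ∧ x ≤ q.2 then h q.2 - h q.1 else 0)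
    ∂((dens p).prod (dens p))) / p x

/-- The exact first-order remainder
`R₁ = E[h'(X₃)h'(X₄)(g₁(X₄) − g₁(X₃))² 1{X₁ ≤ X₃ ≤ X₄ ≤ X₂}/(p(X₃)p(X₄))]`
for `X₁, X₂, X₃, X₄` i.i.d. ~ `p`. -/
noncomputable def R1 (p h' g1 : ℝ → ℝ) : ℝ :=
  ∫ y : Fin 4 → ℝ,
    (if y 0 ≤ y 2 ∧ y 2 ≤ y 3 ∧ y 3 ≤ y 1 then
      h' (y 2) * h' (y 3) * (g1 (y 3) - g1 (y 2)) ^ 2 / (p (y 2) * p (y 3))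
    else 0) ∂(Measure.pi fun _ : Fin 4 => dens p)

theorem lintegral_lintegral_eq_two_mul_of_symm {μ : Measure ℝ} [SFinite μ]
    {K : ℝ → ℝ → ENNReal} (hK : Measurable (Function.uncurry K))
    (hsymm : ∀ s t, K s t = K t s) (hdiag : ∀ s, K s s = 0) :
    ∫⁻ s, ∫⁻ t, K s t ∂μ ∂μ = 2 * ∫⁻ s, ∫⁻ t, (if s ≤ t then K s t else 0) ∂μ ∂μ := by
  have hmeas : Measurable fun q : ℝ × ℝ => if q.1 ≤ q.2 then K q.1 q.2 else 0 :=
    Measurable.ite (measurableSet_le measurable_fst measurable_snd) hK measurable_const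
  have hsplit : ∀ s t, K s t = (if s ≤ t then K s t else 0) + (if t ≤ s then K t s else 0) := by
    intro s t
    rcases lt_trichotomy s t with h | h | h
    · simp [h.le, h.not_ge]
    · simp [h, hdiag]
    · simp [h.le, h.not_ge, hsymm t s]
  calc ∫⁻ s, ∫⁻ t, K s t ∂μ ∂μ
      = ∫⁻ s, (∫⁻ t, (if s ≤ t then K s t else 0) ∂μ +
          ∫⁻ t, (if t ≤ s then K t s else 0) ∂μ) ∂μ := by
        refine lintegral_congr fun s => ?_
        refine Eq.trans ?_ (lintegral_add_left (hmeas.comp measurable_prodMk_left) _)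
        exact lintegral_congr fun t => hsplit s t
    _ = _ := by
        rw [lintegral_add_left (Measurable.lintegral_prod_right' hmeas), two_mul]
        congr 1
        exact lintegral_lintegral_swap (hmeas.comp measurable_swap).aemeasurable

/-- Lagrange's identity for the Cauchy–Schwarz inequality, with the remainder written as an
integral over ordered pairs. -/
theorem ofReal_sq_integral_add_lintegral_ordered {μ : Measure ℝ} [SFinite μ] {φ γ : ℝ → ℝ}
    (hφm : Measurable φ) (hγm : Measurable γ) (hφ : Integrable φ μ) (hγ : Integrable γ μ)
    (hpos : ∀ᵐ x ∂μ, 0 < φ x) (hfin : ∫⁻ t, ENNReal.ofReal (γ t ^ 2 / φ t) ∂μ ≠ ⊤) :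
    ENNReal.ofReal ((∫ t, γ t ∂μ) ^ 2) +
      ∫⁻ s, ∫⁻ t, (if s ≤ t then
        ENNReal.ofReal (φ s * φ t * (γ t / φ t - γ s / φ s) ^ 2) else 0) ∂μ ∂μ =
      ENNReal.ofReal (∫ t, φ t ∂μ) * ∫⁻ t, ENNReal.ofReal (γ t ^ 2 / φ t) ∂μ := by
  set u : ℝ → ℝ := fun t => γ t ^ 2 / φ t with hu
  have hu0 : 0 ≤ᵐ[μ] u := by
    filter_upwards [hpos] with x hx
    exact div_nonneg (sq_nonneg _) hx.le
  have hum : Measurable u := (hγm.pow_const 2).div hφm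
  have hui : Integrable u μ :=
    (lintegral_ofReal_ne_top_iff_integrable hum.aestronglyMeasurable hu0).1 hfin
  set K : ℝ → ℝ → ℝ := fun s t => φ s * φ t * (γ t / φ t - γ s / φ s) ^ 2 with hKdef
  have hKm : Measurable (Function.uncurry K) := by
    simp only [hKdef, Function.uncurry_def]; fun_prop
  have hpos1 : ∀ᵐ q ∂(μ.prod μ), 0 < φ q.1 := Measure.quasiMeasurePreserving_fst.ae hpos
  have hpos2 : ∀ᵐ q ∂(μ.prod μ), 0 < φ q.2 := Measure.quasiMeasurePreserving_snd.ae hpos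
  have hKeq : Function.uncurry K =ᵐ[μ.prod μ]
      fun q => φ q.1 * u q.2 + u q.1 * φ q.2 - 2 * (γ q.1 * γ q.2) := by
    filter_upwards [hpos1, hpos2] with q h1 h2
    simp only [hKdef, hu, Function.uncurry_def]
    field_simp
    ring
  have hK0 : 0 ≤ᵐ[μ.prod μ] Function.uncurry K := by
    filter_upwards [hpos1, hpos2] with q h1 h2
    simp only [hKdef, Function.uncurry_def, Pi.zero_apply]
    positivity
  have i1 := hφ.mul_prod hui
  have i2 := hui.mul_prod hφ
  have i3 := (hγ.mul_prod hγ).const_mul 2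
  have i12 : Integrable (fun q : ℝ × ℝ => φ q.1 * u q.2 + u q.1 * φ q.2) (μ.prod μ) := i1.add i2
  have hKi : Integrable (Function.uncurry K) (μ.prod μ) :=
    (i12.sub i3).congr hKeq.symm
  have hKint : ∫ q, Function.uncurry K q ∂(μ.prod μ) =
      2 * ((∫ t, φ t ∂μ) * (∫ t, u t ∂μ) - (∫ t, γ t ∂μ) ^ 2) := by
    rw [integral_congr_ae hKeq, integral_sub i12 i3, integral_add i1 i2,
      integral_const_mul, integral_prod_mul, integral_prod_mul, integral_prod_mul]
    ring
  have hdbl := lintegral_lintegral_eq_two_mul_of_symm (μ := μ)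
    (K := fun s t => ENNReal.ofReal (K s t)) hKm.ennreal_ofReal
    (fun s t => by congr 1; simp only [hKdef]; ring) (fun s => by simp [hKdef])
  have hprod : ∫⁻ s, ∫⁻ t, ENNReal.ofReal (K s t) ∂μ ∂μ =
      ENNReal.ofReal (2 * ((∫ t, φ t ∂μ) * (∫ t, u t ∂μ) - (∫ t, γ t ∂μ) ^ 2)) := by
    rw [← hKint, ofReal_integral_eq_lintegral_ofReal hKi hK0,
      lintegral_prod _ hKm.ennreal_ofReal.aemeasurable]
    rfl
  have hnn : 0 ≤ (∫ t, φ t ∂μ) * (∫ t, u t ∂μ) - (∫ t, γ t ∂μ) ^ 2 := by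
    have := integral_nonneg_of_ae hK0
    rw [hKint] at this
    linarith
  rw [hprod, ENNReal.ofReal_mul (by norm_num), ENNReal.ofReal_ofNat] at hdbl
  have hhalf := (ENNReal.mul_right_inj (by norm_num) (by norm_num)).1 hdbl
  have hφ0 : 0 ≤ ∫ t, φ t ∂μ := integral_nonneg_of_ae (hpos.mono fun x hx => hx.le)
  rw [← hhalf, ← ENNReal.ofReal_add (sq_nonneg _) hnn, ← ofReal_integral_eq_lintegral_ofReal hui hu0,
    ← ENNReal.ofReal_mul hφ0]
  congr 1
  ring

theorem lintegral_pi_fin_succ {n : ℕ} (μ : Measure ℝ) [SigmaFinite μ]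
    {f : (Fin (n + 1) → ℝ) → ENNReal} (hf : Measurable f) :
    ∫⁻ y, f y ∂(Measure.pi fun _ : Fin (n + 1) => μ) =
      ∫⁻ a, ∫⁻ y, f (Fin.cons a y) ∂(Measure.pi fun _ : Fin n => μ) ∂μ := by
  have h := (measurePreserving_piFinSuccAbove (fun _ : Fin (n + 1) => μ) 0).symm
  rw [← h.lintegral_comp hf, lintegral_prod]
  · simp [MeasurableEquiv.piFinSuccAbove, Fin.insertNthEquiv]
  · exact (hf.comp h.measurable).aemeasurable

theorem measurable_fin_cons {n : ℕ} (a : ℝ) :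
    Measurable fun y : Fin n → ℝ => (Fin.cons a y : Fin (n + 1) → ℝ) :=
  measurable_pi_iff.2 fun i => by
    refine Fin.cases ?_ (fun j => ?_) i
    · simp
    · simpa using measurable_pi_apply j

theorem lintegral_pi_fin_four (μ : Measure ℝ) [SigmaFinite μ]
    {f : (Fin 4 → ℝ) → ENNReal} (hf : Measurable f) :
    ∫⁻ y, f y ∂(Measure.pi fun _ : Fin 4 => μ) =
      ∫⁻ a, ∫⁻ b, ∫⁻ s, ∫⁻ t, f ![a, b, s, t] ∂μ ∂μ ∂μ ∂μ := by
  refine (lintegral_pi_fin_succ μ hf).trans (lintegral_congr fun a => ?_)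
  have ha := hf.comp (measurable_fin_cons a)
  refine (lintegral_pi_fin_succ μ ha).trans (lintegral_congr fun b => ?_)
  have hb := ha.comp (measurable_fin_cons b)
  refine (lintegral_pi_fin_succ μ hb).trans (lintegral_congr fun s => ?_)
  have hs := hb.comp (measurable_fin_cons s)
  refine (lintegral_pi_fin_succ μ hs).trans (lintegral_congr fun t => ?_)
  rw [Measure.pi_of_empty, lintegral_dirac]
  simp only [Function.comp_apply]
  congr 1

/-- The variance as an integral over ordered pairs. -/
theorem lintegral_ordered_sq_sub_eq_ofReal_variance {μ : Measure ℝ} [IsProbabilityMeasure μ]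
    {g : ℝ → ℝ} (hg : Measurable g) (hg2 : Integrable (fun x => g x ^ 2) μ) :
    0 ≤ (∫ x, g x ^ 2 ∂μ) - (∫ x, g x ∂μ) ^ 2 ∧
    ∫⁻ s, ∫⁻ t, (if s ≤ t then ENNReal.ofReal ((g t - g s) ^ 2) else 0) ∂μ ∂μ =
      ENNReal.ofReal ((∫ x, g x ^ 2 ∂μ) - (∫ x, g x ∂μ) ^ 2) := by
  have hgi : Integrable g μ :=
    ((memLp_two_iff_integrable_sq hg.aestronglyMeasurable).2 hg2).integrable one_le_two
  have i1 : Integrable (fun q : ℝ × ℝ => g q.1 ^ 2) (μ.prod μ) := hg2.comp_fst μ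
  have i2 : Integrable (fun q : ℝ × ℝ => g q.2 ^ 2) (μ.prod μ) := hg2.comp_snd μ
  have i12 : Integrable (fun q : ℝ × ℝ => g q.1 ^ 2 + g q.2 ^ 2) (μ.prod μ) := i1.add i2
  have i3 := (hgi.mul_prod hgi).const_mul 2
  have hKeq : ∀ q : ℝ × ℝ, (g q.2 - g q.1) ^ 2 =
      g q.1 ^ 2 + g q.2 ^ 2 - 2 * (g q.1 * g q.2) := fun q => by ring
  have hKi : Integrable (fun q : ℝ × ℝ => (g q.2 - g q.1) ^ 2) (μ.prod μ) := by
    simp only [hKeq]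
    exact i12.sub i3
  have hKint : ∫ q : ℝ × ℝ, (g q.2 - g q.1) ^ 2 ∂(μ.prod μ) =
      2 * ((∫ x, g x ^ 2 ∂μ) - (∫ x, g x ∂μ) ^ 2) := by
    simp only [hKeq]
    rw [integral_sub i12 i3, integral_add i1 i2, integral_const_mul, integral_prod_mul,
      integral_fun_fst (fun x => g x ^ 2), integral_fun_snd (fun x => g x ^ 2)]
    simp only [probReal_univ, one_smul]
    ring
  have hnn : 0 ≤ (∫ x, g x ^ 2 ∂μ) - (∫ x, g x ∂μ) ^ 2 := by
    have : 0 ≤ ∫ q : ℝ × ℝ, (g q.2 - g q.1) ^ 2 ∂(μ.prod μ) :=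
      integral_nonneg fun q => sq_nonneg _
    rw [hKint] at this
    linarith
  refine ⟨hnn, ?_⟩
  have hKm : Measurable fun q : ℝ × ℝ => ENNReal.ofReal ((g q.2 - g q.1) ^ 2) := by fun_prop
  have hdbl := lintegral_lintegral_eq_two_mul_of_symm (μ := μ)
    (K := fun s t => ENNReal.ofReal ((g t - g s) ^ 2)) hKm
    (fun s t => by congr 1; ring) (fun s => by simp)
  have hprod := ofReal_integral_eq_lintegral_ofReal hKi (ae_of_all _ fun q => sq_nonneg _)
  rw [lintegral_prod _ hKm.aemeasurable, hKint, hdbl, ENNReal.ofReal_mul (by norm_num),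
    ENNReal.ofReal_ofNat] at hprod
  exact ((ENNReal.mul_right_inj (by norm_num) (by norm_num)).1 hprod).symm

theorem lintegral_dens {p : ℝ → ℝ} (hp : Measurable p) (f : ℝ → ENNReal) :
    ∫⁻ x, f x ∂(dens p) = ∫⁻ x, ENNReal.ofReal (p x) * f x :=
  lintegral_withDensity_eq_lintegral_mul_non_measurable _ hp.ennreal_ofReal
    (ae_of_all _ fun _ => ENNReal.ofReal_lt_top) f

theorem isProbabilityMeasure_dens {p : ℝ → ℝ} (hp0 : ∀ x, 0 ≤ p x) (hp1 : ∫ x, p x = 1) :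
    IsProbabilityMeasure (dens p) := by
  refine ⟨?_⟩
  rw [dens, withDensity_apply _ MeasurableSet.univ, Measure.restrict_univ,
    ← ofReal_integral_eq_lintegral_ofReal (integrable_of_integral_eq_one hp1) (ae_of_all _ hp0),
    hp1, ENNReal.ofReal_one]

theorem ae_dens_of_ae_restrict {p : ℝ → ℝ} (hp : Measurable p) {S : Set ℝ}
    (hS : MeasurableSet S) (hpos : ∀ x, 0 < p x ↔ x ∈ S) {P : ℝ → Prop}
    (hP : ∀ᵐ x ∂(volume.restrict S), P x) : ∀ᵐ x ∂(dens p), x ∈ S ∧ P x := by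
  rw [dens, ae_withDensity_iff hp.ennreal_ofReal]
  filter_upwards [(ae_restrict_iff' hS).1 hP] with x hx h0
  have hxS : x ∈ S := (hpos x).1 (by simpa using h0)
  exact ⟨hxS, hx hxS⟩

/-- Integrating the remainder kernel against `dens p` in its two inner variables cancels the
densities in its denominator. -/
theorem lintegral_lintegral_dens_kernel {p φ γ : ℝ → ℝ} (hp : Measurable p) {a b : ℝ}
    (hpos : ∀ x ∈ Icc a b, 0 < p x) :
    ∫⁻ s, ∫⁻ t, ENNReal.ofReal (if a ≤ s ∧ s ≤ t ∧ t ≤ b then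
        φ s * φ t * (γ t / φ t - γ s / φ s) ^ 2 / (p s * p t) else 0) ∂(dens p) ∂(dens p) =
      ∫⁻ s in Icc a b, ∫⁻ t in Icc a b, (if s ≤ t then
        ENNReal.ofReal (φ s * φ t * (γ t / φ t - γ s / φ s) ^ 2) else 0) := by
  rw [lintegral_dens hp, ← lintegral_indicator measurableSet_Icc]
  refine lintegral_congr fun s => ?_
  by_cases hs : s ∈ Icc a b
  · rw [indicator_of_mem hs, lintegral_dens hp, ← lintegral_const_mul' _ _ ENNReal.ofReal_ne_top,
      ← lintegral_indicator measurableSet_Icc]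
    refine lintegral_congr fun t => ?_
    by_cases ht : t ∈ Icc a b
    · have h1 := hpos s hs
      have h2 := hpos t ht
      rw [indicator_of_mem ht]
      by_cases hst : s ≤ t
      · rw [if_pos ⟨hs.1, hst, ht.2⟩, if_pos hst, ← ENNReal.ofReal_mul h2.le,
          ← ENNReal.ofReal_mul h1.le]
        congr 1
        field_simp
      · rw [if_neg (fun h => hst h.2.1), if_neg hst]
        simp
    · rw [indicator_of_notMem ht, if_neg (fun h => ht ⟨h.1.trans h.2.1, h.2.2⟩)]
      simp
  · rw [indicator_of_notMem hs]
    have : ∀ t, ¬ (a ≤ s ∧ s ≤ t ∧ t ≤ b) := fun t h => hs ⟨h.1, h.2.1.trans h.2.2⟩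
    simp [this]

theorem LocAC.integrableOn_Icc {S : Set ℝ} {h h' : ℝ → ℝ} (hAC : LocAC S h h') {a b : ℝ}
    (ha : a ∈ S) (hb : b ∈ S) (hab : a ≤ b) : IntegrableOn h' (Icc a b) :=
  (intervalIntegrable_iff_integrableOn_Icc_of_le hab).1 (hAC a ha b hb).1

theorem LocAC.setIntegral_Icc {S : Set ℝ} {h h' : ℝ → ℝ} (hAC : LocAC S h h') {a b : ℝ}
    (ha : a ∈ S) (hb : b ∈ S) (hab : a ≤ b) : ∫ t in Icc a b, h' t = h b - h a := by
  rw [(hAC a ha b hb).2, intervalIntegral.integral_of_le hab, integral_Icc_eq_integral_Ioc]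

theorem measurable_setLIntegral_Icc {f : ℝ → ENNReal} (hf : Measurable f) :
    Measurable fun q : ℝ × ℝ => ∫⁻ t in Icc q.1 q.2, f t := by
  have hset : MeasurableSet {z : (ℝ × ℝ) × ℝ | z.2 ∈ Icc z.1.1 z.1.2} :=
    (measurableSet_le measurable_fst.fst measurable_snd).inter
      (measurableSet_le measurable_snd measurable_fst.snd)
  have hind : Measurable fun z : (ℝ × ℝ) × ℝ => (Icc z.1.1 z.1.2).indicator f z.2 :=
    (hf.comp measurable_snd).indicator hset
  simp only [← lintegral_indicator measurableSet_Icc]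
  exact hind.lintegral_prod_right'

/-- The increment of `h` between two points times the energy `∫ g'² / h'` between them integrates
to the main term of the expansion. -/
theorem lintegral_energy_eq_ofReal_main {p : ℝ → ℝ} {S : Set ℝ} (hSopen : IsOpen S)
    (hSconn : S.OrdConnected) (hpmeas : Measurable p) (hp0 : ∀ x, 0 ≤ p x)
    (hppos : ∀ x : ℝ, 0 < p x ↔ x ∈ S) (hp1 : ∫ x, p x = 1) {h h' g' : ℝ → ℝ}
    (hhmeas : Measurable h) (hh'meas : Measurable h') (hg'meas : Measurable g')
    (hACh : LocAC S h h') (hh'pos : ∀ᵐ x ∂(volume.restrict S), 0 < h' x)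
    (hhint : Integrable h (dens p))
    (hmain : Integrable (fun x => g' x ^ 2 / h' x * Gamma1 p h x) (dens p)) :
    0 ≤ (∫ x, g' x ^ 2 / h' x * Gamma1 p h x ∂(dens p)) ∧
    ∫⁻ q : ℝ × ℝ, (ENNReal.ofReal (h q.2 - h q.1) *
        ∫⁻ t in Icc q.1 q.2, ENNReal.ofReal (g' t ^ 2 / h' t)) ∂((dens p).prod (dens p)) =
      ENNReal.ofReal (∫ x, g' x ^ 2 / h' x * Gamma1 p h x ∂(dens p)) := by
  have := isProbabilityMeasure_dens hp0 hp1
  have hae := ae_dens_of_ae_restrict hpmeas hSopen.measurableSet hppos hh'pos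
  set ν := (dens p).prod (dens p) with hν
  have hq1 : ∀ᵐ q ∂ν, q.1 ∈ S := Measure.quasiMeasurePreserving_fst.ae (hae.mono fun _ h => h.1)
  have hq2 : ∀ᵐ q ∂ν, q.2 ∈ S := Measure.quasiMeasurePreserving_snd.ae (hae.mono fun _ h => h.1)
  have hmono : ∀ a ∈ S, ∀ b ∈ S, a ≤ b → 0 ≤ h b - h a := by
    intro a ha b hb hab
    rw [← hACh.setIntegral_Icc ha hb hab]
    refine integral_nonneg_of_ae ?_
    filter_upwards [ae_restrict_of_ae_restrict_of_subset (hSconn.out ha hb) hh'pos] with x hx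
      using hx.le
  have hk0 : ∀ x, 0 ≤ᵐ[ν] fun q : ℝ × ℝ => if q.1 ≤ x ∧ x ≤ q.2 then h q.2 - h q.1 else 0 := by
    intro x
    filter_upwards [hq1, hq2] with q h1 h2
    simp only [Pi.zero_apply]
    split_ifs with hx
    · exact hmono _ h1 _ h2 (hx.1.trans hx.2)
    · exact le_rfl
  have hki : ∀ x,
      Integrable (fun q : ℝ × ℝ => if q.1 ≤ x ∧ x ≤ q.2 then h q.2 - h q.1 else 0) ν := by
    intro x
    have hd : Integrable (fun q : ℝ × ℝ => h q.2 - h q.1) ν :=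
      (hhint.comp_snd (dens p)).sub (hhint.comp_fst (dens p))
    have hset : MeasurableSet {q : ℝ × ℝ | q.1 ≤ x ∧ x ≤ q.2} :=
      (measurableSet_le measurable_fst measurable_const).inter
        (measurableSet_le measurable_const measurable_snd)
    refine (hd.indicator hset).congr (ae_of_all _ fun q => ?_)
    simp only [indicator_apply, mem_ofPred_eq]
  have hΓ0 : ∀ x, 0 ≤ Gamma1 p h x := fun x =>
    div_nonneg (integral_nonneg_of_ae (hk0 x)) (hp0 x)
  have hu0 : 0 ≤ᵐ[dens p] fun x => g' x ^ 2 / h' x * Gamma1 p h x := by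
    filter_upwards [hae] with x hx
    exact mul_nonneg (div_nonneg (sq_nonneg _) hx.2.le) (hΓ0 x)
  refine ⟨integral_nonneg_of_ae hu0, ?_⟩
  have hset : MeasurableSet {z : (ℝ × ℝ) × ℝ | z.1.1 ≤ z.2 ∧ z.2 ≤ z.1.2} :=
    (measurableSet_le measurable_fst.fst measurable_snd).inter
      (measurableSet_le measurable_snd measurable_fst.snd)
  have hjoint : Measurable fun z : (ℝ × ℝ) × ℝ =>
      ENNReal.ofReal (if z.1.1 ≤ z.2 ∧ z.2 ≤ z.1.2 then h z.1.2 - h z.1.1 else 0) *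
        ENNReal.ofReal (g' z.2 ^ 2 / h' z.2) :=
    (Measurable.ite hset (by fun_prop) measurable_const).ennreal_ofReal.mul (by fun_prop)
  calc ∫⁻ q : ℝ × ℝ, (ENNReal.ofReal (h q.2 - h q.1) *
        ∫⁻ t in Icc q.1 q.2, ENNReal.ofReal (g' t ^ 2 / h' t)) ∂ν
      = ∫⁻ q : ℝ × ℝ, (∫⁻ t,
          ENNReal.ofReal (if q.1 ≤ t ∧ t ≤ q.2 then h q.2 - h q.1 else 0) *
            ENNReal.ofReal (g' t ^ 2 / h' t)) ∂ν := by
        refine lintegral_congr fun q => ?_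
        rw [← lintegral_const_mul' _ _ ENNReal.ofReal_ne_top, ← lintegral_indicator measurableSet_Icc]
        refine lintegral_congr fun t => ?_
        simp only [indicator_apply, mem_Icc]
        split_ifs <;> simp
    _ = ∫⁻ t, ∫⁻ q : ℝ × ℝ,
          ENNReal.ofReal (if q.1 ≤ t ∧ t ≤ q.2 then h q.2 - h q.1 else 0) *
            ENNReal.ofReal (g' t ^ 2 / h' t) ∂ν :=
        lintegral_lintegral_swap hjoint.aemeasurable
    _ = ∫⁻ t, ENNReal.ofReal (p t) * ENNReal.ofReal (g' t ^ 2 / h' t * Gamma1 p h t) := by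
        refine lintegral_congr fun t => ?_
        rw [lintegral_mul_const' _ _ ENNReal.ofReal_ne_top,
          ← ofReal_integral_eq_lintegral_ofReal (hki t) (hk0 t), ENNReal.ofReal_mul' (hΓ0 t),
          mul_left_comm, ← ENNReal.ofReal_mul (hp0 t), mul_comm]
        congr 2
        rcases (hp0 t).eq_or_lt with h0 | h0
        · rw [← h0, zero_mul]
          refine integral_eq_zero_of_ae ?_
          filter_upwards [hq1, hq2] with q h1 h2
          refine if_neg fun ht => ?_
          exact h0.not_lt ((hppos t).2 (hSconn.out h1 h2 ht))
        · rw [Gamma1, mul_div_cancel₀ _ h0.ne']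
    _ = _ := by
        rw [← lintegral_dens hpmeas, ofReal_integral_eq_lintegral_ofReal hmain hu0]

/-- First-order variance expansion with exact remainder, continuous case:
`Var[g(X)] = E[(g'(X))²/h'(X) · Γ₁(X)] − R₁` with `R₁ ≥ 0`; in particular
`Var[g(X)] ≤ E[(g'(X))² Γ₁(X)/h'(X)]`. -/
theorem first_order_variance_expansion_continuous
    (p : ℝ → ℝ) (S : Set ℝ) (hSopen : IsOpen S) (hSconn : S.OrdConnected)
    (hpmeas : Measurable p) (hp0 : ∀ x, 0 ≤ p x)
    (hppos : ∀ x : ℝ, 0 < p x ↔ x ∈ S)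
    (hp1 : ∫ x, p x = 1)
    (h h' g g' : ℝ → ℝ)
    (hhmeas : Measurable h) (hh'meas : Measurable h')
    (hgmeas : Measurable g) (hg'meas : Measurable g')
    (hACh : LocAC S h h') (hACg : LocAC S g g')
    (hh'pos : ∀ᵐ x ∂(volume.restrict S), 0 < h' x)
    (hhint : Integrable h (dens p))
    (hg2 : Integrable (fun x => g x ^ 2) (dens p))
    (hmain : Integrable (fun x => g' x ^ 2 / h' x * Gamma1 p h x) (dens p))
    (hrem : Integrable
      (fun y : Fin 4 → ℝ =>
        if y 0 ≤ y 2 ∧ y 2 ≤ y 3 ∧ y 3 ≤ y 1 then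
          h' (y 2) * h' (y 3) *
            ((g' (y 3) / h' (y 3)) - (g' (y 2) / h' (y 2))) ^ 2 / (p (y 2) * p (y 3))
        else 0) (Measure.pi fun _ : Fin 4 => dens p)) :
    (∫ x, g x ^ 2 ∂(dens p)) - (∫ x, g x ∂(dens p)) ^ 2 =
        (∫ x, g' x ^ 2 / h' x * Gamma1 p h x ∂(dens p)) -
          R1 p h' (fun x => g' x / h' x) ∧
      0 ≤ R1 p h' (fun x => g' x / h' x) ∧
      (∫ x, g x ^ 2 ∂(dens p)) - (∫ x, g x ∂(dens p)) ^ 2 ≤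
        ∫ x, g' x ^ 2 / h' x * Gamma1 p h x ∂(dens p) := by
  have := isProbabilityMeasure_dens hp0 hp1
  have hae := ae_dens_of_ae_restrict hpmeas hSopen.measurableSet hppos hh'pos
  obtain ⟨hM0, hM⟩ := lintegral_energy_eq_ofReal_main hSopen hSconn hpmeas hp0 hppos hp1 hhmeas
    hh'meas hg'meas hACh hh'pos hhint hmain
  obtain ⟨hV0, hV⟩ := lintegral_ordered_sq_sub_eq_ofReal_variance hgmeas hg2
  set kernel : (Fin 4 → ℝ) → ℝ := fun y =>
    if y 0 ≤ y 2 ∧ y 2 ≤ y 3 ∧ y 3 ≤ y 1 then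
      h' (y 2) * h' (y 3) *
        ((g' (y 3) / h' (y 3)) - (g' (y 2) / h' (y 2))) ^ 2 / (p (y 2) * p (y 3))
    else 0 with hkernel
  have hkm : Measurable kernel := by
    refine Measurable.ite ?_ (by fun_prop) measurable_const
    have hle : ∀ i j : Fin 4, MeasurableSet {y : Fin 4 → ℝ | y i ≤ y j} := fun i j =>
      measurableSet_le (measurable_pi_apply i) (measurable_pi_apply j)
    exact (hle 0 2).inter ((hle 2 3).inter (hle 3 1))
  have hcoord : ∀ i : Fin 4, ∀ᵐ y ∂(Measure.pi fun _ : Fin 4 => dens p), 0 < h' (y i) :=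
    fun i => (Measure.quasiMeasurePreserving_eval (fun _ : Fin 4 => dens p) i).ae
      (hae.mono fun _ hx => hx.2)
  have hk0 : 0 ≤ᵐ[Measure.pi fun _ : Fin 4 => dens p] kernel := by
    filter_upwards [hcoord 2, hcoord 3] with y h2 h3
    simp only [hkernel, Pi.zero_apply]
    split_ifs
    · exact div_nonneg (by positivity) (mul_nonneg (hp0 _) (hp0 _))
    · exact le_rfl
  have hR0 : 0 ≤ R1 p h' (fun x => g' x / h' x) := integral_nonneg_of_ae hk0
  have hR : ENNReal.ofReal (R1 p h' (fun x => g' x / h' x)) =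
      ∫⁻ a, ∫⁻ b, ∫⁻ s, ∫⁻ t, ENNReal.ofReal (kernel ![a, b, s, t])
        ∂(dens p) ∂(dens p) ∂(dens p) ∂(dens p) := by
    rw [← lintegral_pi_fin_four (dens p) hkm.ennreal_ofReal]
    exact ofReal_integral_eq_lintegral_ofReal hrem hk0
  have hWm : Measurable fun q : ℝ × ℝ => ∫⁻ s, ∫⁻ t, ENNReal.ofReal (kernel ![q.1, q.2, s, t])
      ∂(dens p) ∂(dens p) := by
    refine Measurable.lintegral_prod_right (f := fun q : ℝ × ℝ => fun s => _) ?_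
    refine Measurable.lintegral_prod_right
      (f := fun z : (ℝ × ℝ) × ℝ => fun t => ENNReal.ofReal (kernel ![z.1.1, z.1.2, z.2, t])) ?_
    refine (hkm.comp (measurable_pi_iff.2 fun i => ?_)).ennreal_ofReal
    fin_cases i <;> simp <;> fun_prop
  have hGm : Measurable fun q : ℝ × ℝ =>
      if q.1 ≤ q.2 then ENNReal.ofReal ((g q.2 - g q.1) ^ 2) else 0 :=
    Measurable.ite (measurableSet_le measurable_fst measurable_snd) (by fun_prop) measurable_const
  rw [← lintegral_prod _ hGm.aemeasurable] at hV
  rw [← lintegral_prod _ hWm.aemeasurable] at hR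
  set ν := (dens p).prod (dens p) with hν
  have hq1 : ∀ᵐ q ∂ν, q.1 ∈ S := Measure.quasiMeasurePreserving_fst.ae (hae.mono fun _ h => h.1)
  have hq2 : ∀ᵐ q ∂ν, q.2 ∈ S := Measure.quasiMeasurePreserving_snd.ae (hae.mono fun _ h => h.1)
  have hEm : AEMeasurable (fun q : ℝ × ℝ => ENNReal.ofReal (h q.2 - h q.1) *
      ∫⁻ t in Icc q.1 q.2, ENNReal.ofReal (g' t ^ 2 / h' t)) ν :=
    ((by fun_prop : Measurable fun q : ℝ × ℝ => ENNReal.ofReal (h q.2 - h q.1)).mul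
      (measurable_setLIntegral_Icc (by fun_prop))).aemeasurable
  have hfin := ae_lt_top' hEm (by rw [hM]; exact ENNReal.ofReal_ne_top)
  have hpair : ∀ᵐ q ∂ν, (if q.1 ≤ q.2 then ENNReal.ofReal ((g q.2 - g q.1) ^ 2) else 0) +
      ∫⁻ s, ∫⁻ t, ENNReal.ofReal (kernel ![q.1, q.2, s, t]) ∂(dens p) ∂(dens p) =
      ENNReal.ofReal (h q.2 - h q.1) * ∫⁻ t in Icc q.1 q.2, ENNReal.ofReal (g' t ^ 2 / h' t) := by
    filter_upwards [hq1, hq2, hfin] with q ha hb hlt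
    have hsub := hSconn.out ha hb
    refine (congrArg₂ (· + ·) rfl (lintegral_lintegral_dens_kernel (φ := h') (γ := g') hpmeas
      fun x hx => (hppos x).2 (hsub hx))).trans ?_
    have hpos := ae_restrict_of_ae_restrict_of_subset hsub hh'pos
    rcases lt_trichotomy q.1 q.2 with hab | hab | hab
    · have hlag := ofReal_sq_integral_add_lintegral_ordered (μ := volume.restrict (Icc q.1 q.2))
        hh'meas hg'meas (hACh.integrableOn_Icc ha hb hab.le) (hACg.integrableOn_Icc ha hb hab.le)
        hpos
      have hinc : 0 < h q.2 - h q.1 := by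
        rw [← hACh.setIntegral_Icc ha hb hab.le, integral_pos_iff_support_of_nonneg_ae
          (hpos.mono fun x hx => hx.le) (hACh.integrableOn_Icc ha hb hab.le)]
        have hsupp : volume.restrict (Icc q.1 q.2) (Function.support h') =
            volume.restrict (Icc q.1 q.2) univ :=
          measure_congr (by
            filter_upwards [hpos] with x hx using propext ⟨fun _ => trivial, fun _ => hx.ne'⟩)
        rw [hsupp]
        simpa using hab
      rw [hACh.setIntegral_Icc ha hb hab.le, hACg.setIntegral_Icc ha hb hab.le] at hlag
      rw [if_pos hab.le]
      refine hlag fun htop => ?_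
      rw [htop, ENNReal.mul_top (ENNReal.ofReal_pos.2 hinc).ne'] at hlt
      exact lt_irrefl _ hlt
    · simp [hab]
    · simp [hab.not_ge, Icc_eq_empty]
  have hsum := lintegral_congr_ae hpair
  rw [lintegral_add_left hGm, hV, ← hR, hM, ← ENNReal.ofReal_add hV0 hR0,
    ENNReal.ofReal_eq_ofReal_iff (add_nonneg hV0 hR0) hM0] at hsum
  exact ⟨by linarith, hR0, by linarith⟩
end

section
/- (Poisson variance bounds.) Let λ > 0 and let X have the Poisson distribution with mean λ. For f : ℕ → ℝ define the backward difference Δ⁻f(x) = f(x) − f(x−1) for x ≥ 1 (with X · Δ⁻f(X) interpreted as 0 when X = 0) and the forward difference Δ⁺f(x) = f(x+1) − f(x). If E[f(X)²] < ∞, E[X (Δ⁻f(X))²] < ∞ and E[(Δ⁺f(X))²] < ∞, then: (i) (E[X Δ⁻f(X)])²/λ ≤ Var[f(X)] ≤ E[X (Δ⁻f(X))²]; and (ii) Var[f(X)] ≤ λ E[(Δ⁺f(X))²]. -/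
open scoped BigOperators

open Finset

/-- The mass function of the Poisson distribution with mean `lam`. -/
noncomputable def poissonMass (lam : ℝ) (x : ℕ) : ℝ :=
  Real.exp (-lam) * lam ^ x / (Nat.factorial x)

namespace poissonMass

variable {lam : ℝ}

lemma pos (hlam : 0 < lam) (x : ℕ) : 0 < poissonMass lam x := by
  unfold poissonMass
  positivity

lemma succ_mul (lam : ℝ) (x : ℕ) :
    ((x : ℝ) + 1) * poissonMass lam (x + 1) = lam * poissonMass lam x := by
  unfold poissonMass
  rw [Nat.factorial_succ]
  push_cast
  field_simp
  ring

lemma hasSum (hlam : 0 < lam) : HasSum (poissonMass lam) 1 :=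
  ProbabilityTheory.hasSum_one_poissonMeasure ⟨lam, hlam.le⟩

/-- The Stein identity `E[X h(X)] = λ E[h(X + 1)]`. -/
lemma hasSum_id_mul {h : ℕ → ℝ} {a : ℝ}
    (ha : HasSum (fun x => h (x + 1) * poissonMass lam x) a) :
    HasSum (fun x : ℕ => (x : ℝ) * h x * poissonMass lam x) (lam * a) := by
  rw [← hasSum_nat_add_iff' 1, sum_range_one, Nat.cast_zero, zero_mul, zero_mul, sub_zero]
  refine (ha.mul_left lam).congr_fun fun x => ?_
  push_cast
  linear_combination h (x + 1) * succ_mul lam x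

lemma summable_of_sq (hlam : 0 < lam) {h : ℕ → ℝ}
    (hh : Summable (fun x => h x ^ 2 * poissonMass lam x)) :
    Summable (fun x => h x * poissonMass lam x) := by
  refine Summable.of_norm_bounded (hh.add (hasSum hlam).summable) fun x => ?_
  have hp := pos hlam x
  rw [Real.norm_eq_abs, abs_mul, abs_of_pos hp, ← add_one_mul]
  gcongr
  nlinarith [sq_abs (h x), sq_nonneg (|h x| - 1)]

lemma sum_id_mul (lam : ℝ) (k : ℕ) :
    ∑ x ∈ range (k + 1), (x : ℝ) * poissonMass lam x =
      lam * ∑ x ∈ range k, poissonMass lam x := by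
  rw [sum_range_succ', mul_sum]
  simp [succ_mul]

lemma sq_sub_le (f : ℕ → ℝ) {x n : ℕ} (hx : x ≤ n) :
    (f n - f x) ^ 2 ≤ ((n : ℝ) - x) * ∑ k ∈ Ico x n, (f (k + 1) - f k) ^ 2 := by
  have h := sq_sum_le_card_mul_sum_sq (s := Ico x n) (f := fun k => f (k + 1) - f k)
  rwa [sum_Ico_sub f hx, Nat.card_Ico, Nat.cast_sub hx] at h

lemma sum_sq_sub_le (hlam : 0 < lam) (f : ℕ → ℝ) (n : ℕ) :
    ∑ x ∈ range n, poissonMass lam x * (f n - f x) ^ 2 ≤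
      ∑ k ∈ range n, (n * ∑ x ∈ range (k + 1), poissonMass lam x -
        lam * ∑ x ∈ range k, poissonMass lam x) * (f (k + 1) - f k) ^ 2 := by
  calc ∑ x ∈ range n, poissonMass lam x * (f n - f x) ^ 2
      ≤ ∑ x ∈ range n, ∑ k ∈ Ico x n,
          ((n : ℝ) - x) * poissonMass lam x * (f (k + 1) - f k) ^ 2 := by
        refine sum_le_sum fun x hx => ?_
        rw [← mul_sum]
        calc _ ≤ poissonMass lam x * _ :=
              mul_le_mul_of_nonneg_left (sq_sub_le f (mem_range.1 hx).le) (pos hlam x).le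
          _ = _ := by ring
    _ = ∑ k ∈ range n, ∑ x ∈ range (k + 1),
          ((n : ℝ) - x) * poissonMass lam x * (f (k + 1) - f k) ^ 2 := by
        simp only [range_eq_Ico]
        exact sum_Ico_Ico_comm 0 n _
    _ = _ := by
        refine sum_congr rfl fun k _ => ?_
        rw [← sum_mul, ← sum_id_mul, mul_sum, ← sum_sub_distrib]
        simp only [sub_mul]

/-- The kernel `∑_{y ≤ k < x ≤ n} (x - y) p(y) p(x)` in closed form. -/
noncomputable def truncatedKernel (lam : ℝ) (n k : ℕ) : ℝ :=
  lam * ((∑ x ∈ range n, poissonMass lam x) * (∑ x ∈ range (k + 1), poissonMass lam x) -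
    (∑ x ∈ range k, poissonMass lam x) * (∑ x ∈ range (n + 1), poissonMass lam x))

lemma truncatedKernel_self (lam : ℝ) (n : ℕ) : truncatedKernel lam n n = 0 := by
  simp [truncatedKernel]

lemma truncatedKernel_succ (lam : ℝ) (n k : ℕ) :
    truncatedKernel lam (n + 1) k = truncatedKernel lam n k + poissonMass lam (n + 1) *
      (((n + 1 : ℕ) : ℝ) * ∑ x ∈ range (k + 1), poissonMass lam x -
        lam * ∑ x ∈ range k, poissonMass lam x) := by
  unfold truncatedKernel
  rw [sum_range_succ _ (n + 1), sum_range_succ _ n]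
  push_cast
  linear_combination -(∑ x ∈ range (k + 1), poissonMass lam x) * succ_mul lam n

lemma truncatedKernel_le (hlam : 0 < lam) (n k : ℕ) :
    truncatedKernel lam n k ≤ lam * poissonMass lam k := by
  have hF (m : ℕ) : 0 ≤ ∑ x ∈ range m, poissonMass lam x :=
    sum_nonneg fun x _ => (pos hlam x).le
  have hF1 : ∑ x ∈ range n, poissonMass lam x ≤ 1 :=
    sum_le_hasSum _ (fun x _ => (pos hlam x).le) (hasSum hlam)
  have hk := pos hlam k
  have hn := pos hlam n
  unfold truncatedKernel
  gcongr
  rw [sum_range_succ _ k, sum_range_succ _ n]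
  nlinarith [mul_nonneg (hF k) hn.le]

/-- The truncated Poincaré inequality, with its exact weights. -/
lemma truncated_poincare_weighted (hlam : 0 < lam) (f : ℕ → ℝ) (n : ℕ) :
    (∑ x ∈ range (n + 1), poissonMass lam x) *
          (∑ x ∈ range (n + 1), f x ^ 2 * poissonMass lam x) -
        (∑ x ∈ range (n + 1), f x * poissonMass lam x) ^ 2 ≤
      ∑ k ∈ range n, truncatedKernel lam n k * (f (k + 1) - f k) ^ 2 := by
  induction n with
  | zero =>
    simp only [zero_add, sum_range_one, range_zero, sum_empty]
    exact le_of_eq (by ring)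
  | succ n ih =>
    have hB := mul_le_mul_of_nonneg_left (sum_sq_sub_le hlam f (n + 1)) (pos hlam (n + 1)).le
    have hexp : ∑ x ∈ range (n + 1), poissonMass lam x * (f (n + 1) - f x) ^ 2 =
        f (n + 1) ^ 2 * ∑ x ∈ range (n + 1), poissonMass lam x
          - 2 * f (n + 1) * ∑ x ∈ range (n + 1), f x * poissonMass lam x
          + ∑ x ∈ range (n + 1), f x ^ 2 * poissonMass lam x := by
      rw [mul_sum, mul_sum, ← sum_sub_distrib, ← sum_add_distrib]
      exact sum_congr rfl fun x _ => by ring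
    simp only [truncatedKernel_succ, add_mul, sum_add_distrib, mul_assoc (poissonMass lam (n + 1)),
      ← mul_sum]
    rw [sum_range_succ (fun k => truncatedKernel lam n k * _), truncatedKernel_self]
    rw [hexp] at hB
    simp only [sum_range_succ _ (n + 1)]
    linarith

lemma truncated_poincare (hlam : 0 < lam) (f : ℕ → ℝ) (n : ℕ) :
    (∑ x ∈ range (n + 1), poissonMass lam x) *
          (∑ x ∈ range (n + 1), f x ^ 2 * poissonMass lam x) -
        (∑ x ∈ range (n + 1), f x * poissonMass lam x) ^ 2 ≤
      lam * ∑ k ∈ range n, (f (k + 1) - f k) ^ 2 * poissonMass lam k := by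
  refine (truncated_poincare_weighted hlam f n).trans ?_
  rw [mul_sum]
  refine sum_le_sum fun k _ => ?_
  rw [mul_comm ((f (k + 1) - f k) ^ 2), ← mul_assoc]
  exact mul_le_mul_of_nonneg_right (truncatedKernel_le hlam n k) (sq_nonneg _)

/-- The Poincaré inequality `Var[f(X)] ≤ λ E[(Δ⁺f(X))²]`. -/
lemma poincare (hlam : 0 < lam) {f : ℕ → ℝ}
    (hf : Summable (fun x => f x ^ 2 * poissonMass lam x))
    (hd : Summable (fun x => (f (x + 1) - f x) ^ 2 * poissonMass lam x)) :
    (∑' x, f x ^ 2 * poissonMass lam x) - (∑' x, f x * poissonMass lam x) ^ 2 ≤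
      lam * ∑' x, (f (x + 1) - f x) ^ 2 * poissonMass lam x := by
  have hs := Filter.tendsto_add_atTop_nat 1
  have h0 := (hasSum hlam).tendsto_sum_nat.comp hs
  have h1 := (summable_of_sq hlam hf).hasSum.tendsto_sum_nat.comp hs
  have h2 := hf.hasSum.tendsto_sum_nat.comp hs
  have hlim := le_of_tendsto_of_tendsto' ((h0.mul h2).sub (h1.pow 2))
    (hd.hasSum.tendsto_sum_nat.const_mul lam) (truncated_poincare hlam f)
  rwa [one_mul] at hlim

/-- The lower bound `λ (E[Δ⁺f(X)])² ≤ Var[f(X)]`. -/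
lemma mul_sq_le_variance (hlam : 0 < lam) {f : ℕ → ℝ}
    (hf : Summable (fun x => f x ^ 2 * poissonMass lam x))
    (hd : Summable (fun x => (f (x + 1) - f x) ^ 2 * poissonMass lam x)) :
    lam * (∑' x, (f (x + 1) - f x) * poissonMass lam x) ^ 2 ≤
      (∑' x, f x ^ 2 * poissonMass lam x) - (∑' x, f x * poissonMass lam x) ^ 2 := by
  have h0 := hasSum hlam
  have h1 := (summable_of_sq hlam hf).hasSum
  have h2 := hf.hasSum
  have hg := (summable_of_sq hlam hd).hasSum
  set m := ∑' x, f x * poissonMass lam x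
  set s := ∑' x, f x ^ 2 * poissonMass lam x
  set G := ∑' x, (f (x + 1) - f x) * poissonMass lam x
  have hx : HasSum (fun x : ℕ => (x : ℝ) * 1 * poissonMass lam x) (lam * 1) :=
    hasSum_id_mul (h := fun _ => 1) (by simpa using h0)
  have hxx : HasSum (fun x : ℕ => (x : ℝ) * x * poissonMass lam x) (lam * (lam * 1 + 1)) := by
    refine hasSum_id_mul (h := fun x => (x : ℝ)) ?_
    convert hx.add h0 using 1
    funext x
    push_cast
    ring
  have hxf : HasSum (fun x : ℕ => (x : ℝ) * f x * poissonMass lam x) (lam * (G + m)) := by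
    refine hasSum_id_mul ?_
    convert hg.add h1 using 1
    funext x
    ring
  have hsq : HasSum (fun x : ℕ => (f x - m - G * (x - lam)) ^ 2 * poissonMass lam x)
      (s - m ^ 2 - lam * G ^ 2) := by
    convert ((((h2.add (hxx.mul_left (G ^ 2))).add (h0.mul_left ((G * lam - m) ^ 2))).add
      (hxf.mul_left (-2 * G))).add (h1.mul_left (2 * (G * lam - m)))).add
      (hx.mul_left (-2 * G * (G * lam - m))) using 1
    · funext x
      ring
    · ring
  have := hsq.nonneg fun x => mul_nonneg (sq_nonneg _) (pos hlam x).le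
  linarith

end poissonMass

/-- Poisson variance bounds: for `X ~ Poisson(λ)` with `λ > 0`, backward difference
`Δ⁻f(x) = f(x) − f(x−1)` (with `X·Δ⁻f(X) = 0` at `X = 0`) and forward difference
`Δ⁺f(x) = f(x+1) − f(x)`:
(i) `(E[X Δ⁻f(X)])²/λ ≤ Var[f(X)] ≤ E[X (Δ⁻f(X))²]`;
(ii) `Var[f(X)] ≤ λ E[(Δ⁺f(X))²]`. -/
theorem poisson_variance_bounds (lam : ℝ) (hlam : 0 < lam) (f : ℕ → ℝ)
    (hf2 : Summable (fun x : ℕ =>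
      f x ^ 2 * (Real.exp (-lam) * lam ^ x / (Nat.factorial x))))
    (hd1 : Summable (fun x : ℕ =>
      (x : ℝ) * (f x - f (x - 1)) ^ 2 * (Real.exp (-lam) * lam ^ x / (Nat.factorial x))))
    (hd2 : Summable (fun x : ℕ =>
      (f (x + 1) - f x) ^ 2 * (Real.exp (-lam) * lam ^ x / (Nat.factorial x)))) :
    (∑' x : ℕ, (x : ℝ) * (f x - f (x - 1)) *
          (Real.exp (-lam) * lam ^ x / (Nat.factorial x))) ^ 2 / lam ≤
        (∑' x : ℕ, f x ^ 2 * (Real.exp (-lam) * lam ^ x / (Nat.factorial x))) -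
          (∑' x : ℕ, f x * (Real.exp (-lam) * lam ^ x / (Nat.factorial x))) ^ 2 ∧
      (∑' x : ℕ, f x ^ 2 * (Real.exp (-lam) * lam ^ x / (Nat.factorial x))) -
          (∑' x : ℕ, f x * (Real.exp (-lam) * lam ^ x / (Nat.factorial x))) ^ 2 ≤
        ∑' x : ℕ, (x : ℝ) * (f x - f (x - 1)) ^ 2 *
          (Real.exp (-lam) * lam ^ x / (Nat.factorial x)) ∧
      (∑' x : ℕ, f x ^ 2 * (Real.exp (-lam) * lam ^ x / (Nat.factorial x))) -
          (∑' x : ℕ, f x * (Real.exp (-lam) * lam ^ x / (Nat.factorial x))) ^ 2 ≤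
        lam * ∑' x : ℕ, (f (x + 1) - f x) ^ 2 *
          (Real.exp (-lam) * lam ^ x / (Nat.factorial x)) := by
  change (∑' x : ℕ, (x : ℝ) * (f x - f (x - 1)) * poissonMass lam x) ^ 2 / lam ≤
      (∑' x, f x ^ 2 * poissonMass lam x) - (∑' x, f x * poissonMass lam x) ^ 2 ∧
    (∑' x, f x ^ 2 * poissonMass lam x) - (∑' x, f x * poissonMass lam x) ^ 2 ≤
      ∑' x : ℕ, (x : ℝ) * (f x - f (x - 1)) ^ 2 * poissonMass lam x ∧
    (∑' x, f x ^ 2 * poissonMass lam x) - (∑' x, f x * poissonMass lam x) ^ 2 ≤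
      lam * ∑' x, (f (x + 1) - f x) ^ 2 * poissonMass lam x
  have hS1 := poissonMass.hasSum_id_mul (h := fun x => f x - f (x - 1))
    (poissonMass.summable_of_sq hlam hd2).hasSum
  have hS2 := poissonMass.hasSum_id_mul (h := fun x => (f x - f (x - 1)) ^ 2) hd2.hasSum
  have hlow := poissonMass.mul_sq_le_variance hlam hf2 hd2
  have hup := poissonMass.poincare hlam hf2 hd2
  refine ⟨?_, hS2.tsum_eq.symm ▸ hup, hup⟩
  rw [hS1.tsum_eq]
  convert hlow using 1
  field_simp
end
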